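/- arXiv:1707.08942 — 5 statements merged into one kernel-verified Lean document; each statement's English description precedes it below -/
import Mathlib

section
/- For every real s > 0, ∫_0^∞ x^{s−1} Ai(x) dx = (1/(2π)) · 3^{(4s−7)/6} · Γ((s+1)/3) · Γ(s/3). -/
open MeasureTheory Filter Set

/-- The integrand of the Airy contour integral `∫ exp (z ^ 3 / 3 - a ^ 2 * z) dz`
after the substitution `z = 2 * a * cosh w`. -/
noncomputable def airyKernel (a : ℝ) (w : ℂ) : ℂ :=
  Complex.exp ((2 / 3 * a ^ 3 : ℝ) * Complex.cosh (3 * w)) * ((2 * a : ℝ) * Complex.sinh w)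

lemma differentiable_airyKernel (a : ℝ) : Differentiable ℂ (airyKernel a) := by
  unfold airyKernel
  fun_prop

lemma cosh_three_mul_add_mul_I (u v : ℝ) :
    Complex.cosh (3 * (u + v * Complex.I)) =
      (Real.cosh (3 * u) * Real.cos (3 * v) : ℝ) +
        (Real.sinh (3 * u) * Real.sin (3 * v) : ℝ) * Complex.I := by
  have : (3 : ℂ) * (u + v * Complex.I) = (3 * u : ℝ) + (3 * v : ℝ) * Complex.I := by
    push_cast; ring
  rw [this, Complex.cosh_add, Complex.cosh_mul_I, Complex.sinh_mul_I]
  push_cast; ring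

lemma sinh_add_mul_I (u v : ℝ) :
    Complex.sinh (u + v * Complex.I) =
      (Real.sinh u * Real.cos v : ℝ) + (Real.cosh u * Real.sin v : ℝ) * Complex.I := by
  rw [Complex.sinh_add, Complex.cosh_mul_I, Complex.sinh_mul_I]
  push_cast; ring

lemma airyKernel_add_mul_I (a u v : ℝ) :
    airyKernel a (u + v * Complex.I) =
      Complex.exp ((2 / 3 * a ^ 3 * (Real.cosh (3 * u) * Real.cos (3 * v)) : ℝ) +
        (2 / 3 * a ^ 3 * (Real.sinh (3 * u) * Real.sin (3 * v)) : ℝ) * Complex.I) *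
      ((2 * a * (Real.sinh u * Real.cos v) : ℝ) +
        (2 * a * (Real.cosh u * Real.sin v) : ℝ) * Complex.I) := by
  rw [airyKernel, cosh_three_mul_add_mul_I, sinh_add_mul_I]
  rw [Complex.ofReal_mul (2 / 3 * a ^ 3), Complex.ofReal_mul (2 / 3 * a ^ 3),
    Complex.ofReal_mul (2 * a), Complex.ofReal_mul (2 * a), mul_assoc, mul_assoc, ← mul_add,
    ← mul_add]

lemma exp_mul_re (p q r s : ℝ) :
    (Complex.exp (p + q * Complex.I) * (r + s * Complex.I)).re =
      Real.exp p * (Real.cos q * r - Real.sin q * s) := by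
  simp only [Complex.mul_re, Complex.exp_re, Complex.exp_im, Complex.add_re, Complex.add_im,
    Complex.mul_im, Complex.ofReal_re, Complex.ofReal_im, Complex.I_re, Complex.I_im]
  ring_nf

lemma exp_mul_im (p q r s : ℝ) :
    (Complex.exp (p + q * Complex.I) * (r + s * Complex.I)).im =
      Real.exp p * (Real.cos q * s + Real.sin q * r) := by
  simp only [Complex.mul_re, Complex.exp_re, Complex.exp_im, Complex.add_re, Complex.add_im,
    Complex.mul_im, Complex.ofReal_re, Complex.ofReal_im, Complex.I_re, Complex.I_im]
  ring_nf

lemma airyKernel_pi_div_three_im (a u : ℝ) :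
    (airyKernel a (u + (Real.pi / 3 : ℝ) * Complex.I)).im =
      √3 * a * (Real.cosh u * Real.exp (-(2 / 3 * a ^ 3 * Real.cosh (3 * u)))) := by
  rw [airyKernel_add_mul_I, exp_mul_im, show (3 : ℝ) * (Real.pi / 3) = Real.pi by ring,
    Real.cos_pi, Real.sin_pi, Real.sin_pi_div_three]
  simp only [mul_zero, Real.cos_zero, Real.sin_zero, mul_neg, mul_one]
  ring

lemma airyKernel_pi_div_two_im (a u : ℝ) :
    (airyKernel a (u + (Real.pi / 2 : ℝ) * Complex.I)).im =
      Real.cos ((2 * a * Real.sinh u) ^ 3 / 3 + a ^ 2 * (2 * a * Real.sinh u)) *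
        (2 * a * Real.cosh u) := by
  have : (2 * a * Real.sinh u) ^ 3 / 3 + a ^ 2 * (2 * a * Real.sinh u) =
      2 / 3 * a ^ 3 * Real.sinh (3 * u) := by
    rw [Real.sinh_three_mul]; ring
  rw [airyKernel_add_mul_I, exp_mul_im, this,
    show (3 : ℝ) * (Real.pi / 2) = Real.pi / 2 + Real.pi by ring, Real.cos_add_pi,
    Real.sin_add_pi, Real.cos_pi_div_two, Real.sin_pi_div_two]
  simp

lemma airyKernel_imaginary_axis (a v : ℝ) :
    (airyKernel a ((0 : ℝ) + v * Complex.I)).re = 0 := by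
  rw [airyKernel_add_mul_I, exp_mul_re]
  simp

lemma norm_airyKernel_le {a : ℝ} (ha : 0 < a) {u v : ℝ}
    (hv : v ∈ Icc (Real.pi / 3) (Real.pi / 2)) :
    ‖airyKernel a (u + v * Complex.I)‖ ≤
      Real.exp (-(4 * a ^ 3 / (3 * Real.pi) * Real.cosh (3 * u)) * (3 * Real.pi / 2 - 3 * v)) *
        (2 * a * Real.cosh u) := by
  rw [airyKernel, norm_mul, Complex.norm_exp]
  have hs : ‖Complex.sinh (u + v * Complex.I)‖ ≤ Real.cosh u := by
    rw [sinh_add_mul_I, Complex.norm_add_mul_I]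
    refine Real.sqrt_le_iff.2 ⟨(Real.cosh_pos u).le, ?_⟩
    nlinarith [Real.cosh_sq u, Real.sin_sq_add_cos_sq v, sq_nonneg (Real.cos v)]
  have hc : Real.cos (3 * v) ≤ -(2 / Real.pi * (3 * Real.pi / 2 - 3 * v)) := by
    have h1 := Real.mul_le_sin (x := 3 * Real.pi / 2 - 3 * v) (by linarith [hv.2])
      (by linarith [hv.1])
    have h2 : Real.sin (3 * Real.pi / 2 - 3 * v) = - Real.cos (3 * v) := by
      rw [show 3 * Real.pi / 2 - 3 * v = Real.pi / 2 - 3 * v + Real.pi by ring,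
        Real.sin_add_pi, Real.sin_pi_div_two_sub]
    linarith
  refine mul_le_mul (Real.exp_le_exp.2 ?_) ?_ (norm_nonneg _) (Real.exp_pos _).le
  · rw [cosh_three_mul_add_mul_I]
    have hre : (((2 / 3 * a ^ 3 : ℝ) : ℂ) * ((Real.cosh (3 * u) * Real.cos (3 * v) : ℝ) +
        (Real.sinh (3 * u) * Real.sin (3 * v) : ℝ) * Complex.I)).re =
        2 / 3 * a ^ 3 * Real.cosh (3 * u) * Real.cos (3 * v) := by
      rw [Complex.re_ofReal_mul, Complex.add_re, Complex.re_ofReal_mul, Complex.ofReal_re,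
        Complex.I_re]
      ring
    rw [hre]
    calc _ ≤ 2 / 3 * a ^ 3 * Real.cosh (3 * u) * -(2 / Real.pi * (3 * Real.pi / 2 - 3 * v)) := by
          have := Real.cosh_pos (3 * u)
          gcongr
      _ = _ := by ring
  · rw [norm_mul, Complex.norm_real, Real.norm_of_nonneg (by positivity)]
    gcongr

lemma integral_exp_neg_mul_sub_le {k : ℝ} (hk : 0 < k) (p q : ℝ) :
    ∫ v in p..q, Real.exp (-k * (3 * q - 3 * v)) ≤ 1 / (3 * k) := by
  have hd : ∀ v ∈ uIcc p q, HasDerivAt (fun v => Real.exp (-k * (3 * q - 3 * v)) / (3 * k))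
      (Real.exp (-k * (3 * q - 3 * v))) v := by
    intro v _
    have h := ((((hasDerivAt_id v).const_mul 3).const_sub (3 * q)).const_mul (-k)).exp.div_const
      (3 * k)
    refine h.congr_deriv ?_
    rw [div_eq_iff (by positivity)]
    simp only [id_eq]
    ring
  rw [intervalIntegral.integral_eq_sub_of_hasDerivAt hd
    (Continuous.intervalIntegrable (by fun_prop) _ _)]
  have : 0 ≤ Real.exp (-k * (3 * q - 3 * p)) / (3 * k) := by positivity
  simp only [sub_self, mul_zero, Real.exp_zero]
  linarith

lemma tendsto_integral_airyKernel_vertical {a : ℝ} (ha : 0 < a) :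
    Tendsto (fun U : ℝ => ∫ v in (Real.pi / 3)..(Real.pi / 2), airyKernel a (U + v * Complex.I))
      atTop (nhds 0) := by
  have hlim : Tendsto (fun U : ℝ => Real.pi / (2 * a ^ 2) * U⁻¹) atTop (nhds 0) := by
    have := (tendsto_inv_atTop_zero (𝕜 := ℝ)).const_mul (Real.pi / (2 * a ^ 2))
    rwa [mul_zero] at this
  refine squeeze_zero_norm' ?_ hlim
  filter_upwards [eventually_gt_atTop 0] with U hU
  have hpi := Real.pi_pos
  have hle : Real.pi / 3 ≤ Real.pi / 2 := by linarith
  have hcont : Continuous fun v : ℝ => airyKernel a (U + v * Complex.I) :=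
    (differentiable_airyKernel a).continuous.comp (by fun_prop)
  have hc := Real.cosh_pos U
  have hc3 := Real.cosh_pos (3 * U)
  set k := 4 * a ^ 3 / (3 * Real.pi) * Real.cosh (3 * U) with hk
  have hkpos : 0 < k := by positivity
  have hcosh : U * Real.cosh U ≤ Real.cosh (3 * U) := by
    rw [Real.cosh_three_mul]
    have h1 := Real.self_le_sinh_iff.2 hU.le
    have h2 := Real.cosh_sq U
    have h3 : 4 * Real.cosh U ^ 3 - 3 * Real.cosh U =
        (4 * Real.sinh U ^ 2 + 1) * Real.cosh U := by
      linear_combination 4 * Real.cosh U * h2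
    rw [h3]
    gcongr
    nlinarith [sq_nonneg (2 * Real.sinh U - 1)]
  calc _ ≤ ∫ v in (Real.pi / 3)..(Real.pi / 2), ‖airyKernel a (U + v * Complex.I)‖ :=
        intervalIntegral.norm_integral_le_integral_norm hle
    _ ≤ ∫ v in (Real.pi / 3)..(Real.pi / 2),
          Real.exp (-k * (3 * (Real.pi / 2) - 3 * v)) * (2 * a * Real.cosh U) := by
        refine intervalIntegral.integral_mono_on hle (hcont.norm.intervalIntegrable _ _)
          (Continuous.intervalIntegrable (by fun_prop) _ _) fun v hv => ?_
        have := norm_airyKernel_le ha (u := U) hv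
        rwa [mul_div_assoc 3 Real.pi 2] at this
    _ ≤ 1 / (3 * k) * (2 * a * Real.cosh U) := by
        rw [intervalIntegral.integral_mul_const]
        gcongr
        exact integral_exp_neg_mul_sub_le hkpos _ _
    _ ≤ _ := by
        have : 1 / (3 * k) * (2 * a * Real.cosh U) =
            Real.pi / (2 * a ^ 2) * (Real.cosh U / Real.cosh (3 * U)) := by
          rw [hk]; field_simp; norm_num
        rw [this]
        gcongr
        rw [div_le_iff₀ hc3, inv_mul_eq_div, le_div_iff₀ hU]
        linarith

lemma integral_cosh_mul_exp_neg_cosh_eq (a U : ℝ) :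
    (∫ u in (0 : ℝ)..U,
        √3 * a * (Real.cosh u * Real.exp (-(2 / 3 * a ^ 3 * Real.cosh (3 * u))))) =
      (∫ t in (0 : ℝ)..(2 * a * Real.sinh U), Real.cos (t ^ 3 / 3 + a ^ 2 * t)) -
        (∫ v in (Real.pi / 3)..(Real.pi / 2), airyKernel a (U + v * Complex.I)).re := by
  have hcont := (differentiable_airyKernel a).continuous
  have him : ∀ v : ℝ, (∫ u in (0 : ℝ)..U, airyKernel a (u + v * Complex.I)).im =
      ∫ u in (0 : ℝ)..U, (airyKernel a (u + v * Complex.I)).im := fun v =>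
    (Complex.imCLM.intervalIntegral_comp_comm
      ((hcont.comp (by fun_prop)).intervalIntegrable _ _)).symm
  have hre : (∫ v in (Real.pi / 3)..(Real.pi / 2),
      airyKernel a ((0 : ℝ) + v * Complex.I)).re = 0 := by
    have := Complex.reCLM.intervalIntegral_comp_comm (μ := volume)
      (a := Real.pi / 3) (b := Real.pi / 2)
      (f := fun v : ℝ => airyKernel a ((0 : ℝ) + v * Complex.I))
      ((hcont.comp (by fun_prop)).intervalIntegrable _ _)
    simp only [Complex.reCLM_apply, airyKernel_imaginary_axis] at this
    rw [← this]; simp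
  have hrect := congrArg Complex.im
    (Complex.integral_boundary_rect_eq_zero_of_differentiableOn (airyKernel a)
      ⟨0, Real.pi / 3⟩ ⟨U, Real.pi / 2⟩ (differentiable_airyKernel a).differentiableOn)
  simp only [Complex.add_im, Complex.sub_im, smul_eq_mul, Complex.I_mul_im, Complex.zero_im,
    him, hre, airyKernel_pi_div_three_im, airyKernel_pi_div_two_im] at hrect
  have hsub := intervalIntegral.integral_comp_mul_deriv (a := 0) (b := U)
    (f := fun u => 2 * a * Real.sinh u) (f' := fun u => 2 * a * Real.cosh u)
    (g := fun t => Real.cos (t ^ 3 / 3 + a ^ 2 * t))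
    (fun u _ => (Real.hasDerivAt_sinh u).const_mul _)
    (Continuous.continuousOn (by fun_prop)) (by fun_prop)
  simp only [Function.comp_def, Real.sinh_zero, mul_zero] at hsub
  linarith

lemma integrableOn_exp_neg_cube_add_div (x : ℝ) (hx : 0 < x) :
    IntegrableOn (fun t : ℝ => Real.exp (-(t ^ 3 + x ^ 3 / t ^ 3) / 3)) (Ioi 0) := by
  have h := integrableOn_rpow_mul_exp_neg_mul_rpow (p := 3) (s := 0) (b := 1 / 3)
    (by norm_num) (by norm_num) (by norm_num)
  refine Integrable.mono' h (by fun_prop) ?_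
  filter_upwards [ae_restrict_mem measurableSet_Ioi] with t ht
  have ht : 0 < t := ht
  rw [Real.norm_of_nonneg (Real.exp_pos _).le, Real.rpow_zero, one_mul, Real.exp_le_exp,
    show t ^ (3 : ℝ) = t ^ 3 by exact_mod_cast Real.rpow_natCast t 3]
  have : 0 ≤ x ^ 3 / t ^ 3 := by positivity
  linarith

lemma image_mul_exp_univ {a : ℝ} (ha : 0 < a) :
    (fun u => a * Real.exp u) '' univ = Ioi 0 := by
  rw [image_univ]
  ext t
  constructor
  · rintro ⟨u, rfl⟩
    exact mul_pos ha (Real.exp_pos u)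
  · intro ht
    exact ⟨Real.log (t / a), by
      simp only
      rw [Real.exp_log (div_pos ht ha)]; field_simp⟩

lemma mul_exp_mul_exp_neg_cosh {a : ℝ} (ha : 0 < a) (u : ℝ) :
    |a * Real.exp u| • Real.exp (-((a * Real.exp u) ^ 3 + (a ^ 2) ^ 3 / (a * Real.exp u) ^ 3) / 3) =
      a * (Real.exp u * Real.exp (-(2 / 3 * a ^ 3 * Real.cosh (3 * u)))) := by
  rw [abs_of_pos (by positivity), smul_eq_mul, mul_assoc]
  congr 3
  rw [Real.cosh_eq, Real.exp_neg, show Real.exp (3 * u) = Real.exp u ^ 3 by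
    rw [← Real.exp_nat_mul]; norm_num]
  have := Real.exp_pos u
  field_simp

lemma integral_cosh_mul_exp_neg_cosh {a : ℝ} (ha : 0 < a) :
    IntegrableOn (fun u => Real.cosh u * Real.exp (-(2 / 3 * a ^ 3 * Real.cosh (3 * u))))
      (Ioi 0) ∧
    a * ∫ u in Ioi (0 : ℝ), Real.cosh u * Real.exp (-(2 / 3 * a ^ 3 * Real.cosh (3 * u))) =
      1 / 2 * ∫ t in Ioi (0 : ℝ), Real.exp (-(t ^ 3 + (a ^ 2) ^ 3 / t ^ 3) / 3) := by
  have hderiv : ∀ u ∈ (univ : Set ℝ),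
      HasDerivWithinAt (fun u => a * Real.exp u) (a * Real.exp u) univ u := fun u _ =>
    ((Real.hasDerivAt_exp u).const_mul a).hasDerivWithinAt
  have hinj : InjOn (fun u => a * Real.exp u) univ := fun u _ v _ h =>
    Real.exp_injective (mul_left_cancel₀ ha.ne' h)
  have hint := integrableOn_exp_neg_cube_add_div (a ^ 2) (by positivity)
  rw [← image_mul_exp_univ ha, integrableOn_image_iff_integrableOn_abs_deriv_smul
    MeasurableSet.univ hderiv hinj] at hint
  have hval := integral_image_eq_integral_abs_deriv_smul MeasurableSet.univ hderiv hinj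
    (fun t => Real.exp (-(t ^ 3 + (a ^ 2) ^ 3 / t ^ 3) / 3))
  simp only [mul_exp_mul_exp_neg_cosh ha, image_mul_exp_univ ha, setIntegral_univ,
    integrableOn_univ] at hint hval
  rw [integral_const_mul] at hval
  have hint1 : Integrable fun u : ℝ =>
      Real.exp u * Real.exp (-(2 / 3 * a ^ 3 * Real.cosh (3 * u))) := by
    simpa [ha.ne', mul_assoc] using hint.const_mul a⁻¹
  have hint2 : Integrable fun u : ℝ =>
      Real.exp (-u) * Real.exp (-(2 / 3 * a ^ 3 * Real.cosh (3 * u))) := by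
    simpa using hint1.comp_neg
  have hsymm : ∫ u : ℝ, Real.exp (-u) * Real.exp (-(2 / 3 * a ^ 3 * Real.cosh (3 * u))) =
      ∫ u : ℝ, Real.exp u * Real.exp (-(2 / 3 * a ^ 3 * Real.cosh (3 * u))) := by
    rw [← integral_neg_eq_self]
    simp
  have hcosh : ∀ u : ℝ, Real.cosh u * Real.exp (-(2 / 3 * a ^ 3 * Real.cosh (3 * u))) =
      1 / 2 * (Real.exp u * Real.exp (-(2 / 3 * a ^ 3 * Real.cosh (3 * u))) +
        Real.exp (-u) * Real.exp (-(2 / 3 * a ^ 3 * Real.cosh (3 * u)))) := by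
    intro u
    rw [Real.cosh_eq u]; ring
  have habs := integral_comp_abs
    (f := fun u => Real.cosh u * Real.exp (-(2 / 3 * a ^ 3 * Real.cosh (3 * u))))
  have hfun : ∀ u : ℝ, Real.cosh |u| * Real.exp (-(2 / 3 * a ^ 3 * Real.cosh (3 * |u|))) =
      Real.cosh u * Real.exp (-(2 / 3 * a ^ 3 * Real.cosh (3 * u))) := by
    intro u
    rw [Real.cosh_abs, show 3 * |u| = |3 * u| by simp [abs_mul], Real.cosh_abs]
  simp only [hfun] at habs
  constructor
  · simp only [hcosh]
    exact ((hint1.add hint2).const_mul _).integrableOn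
  · have : ∫ u : ℝ, Real.cosh u * Real.exp (-(2 / 3 * a ^ 3 * Real.cosh (3 * u))) =
        ∫ u : ℝ, Real.exp u * Real.exp (-(2 / 3 * a ^ 3 * Real.cosh (3 * u))) := by
      simp only [hcosh]
      rw [integral_const_mul, integral_add hint1 hint2, hsymm]
      ring
    rw [hval, ← this, habs]
    ring

lemma pi_mul_airy_eq {x y : ℝ} (hx : 0 < x)
    (h : Tendsto (fun T => ∫ t in (0 : ℝ)..T, Real.cos (t ^ 3 / 3 + x * t)) atTop (nhds y)) :
    y = √3 / 2 * ∫ t in Ioi (0 : ℝ), Real.exp (-(t ^ 3 + x ^ 3 / t ^ 3) / 3) := by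
  obtain ⟨a, ha, rfl⟩ : ∃ a : ℝ, 0 < a ∧ a ^ 2 = x := ⟨√x, Real.sqrt_pos.2 hx, Real.sq_sqrt hx.le⟩
  obtain ⟨hint, hval⟩ := integral_cosh_mul_exp_neg_cosh ha
  have hT : Tendsto (fun U => 2 * a * Real.sinh U) atTop atTop := by
    refine Tendsto.const_mul_atTop (by positivity) ?_
    refine tendsto_atTop_mono' atTop ?_ tendsto_id
    filter_upwards [eventually_ge_atTop 0] with U hU
    exact Real.self_le_sinh_iff.2 hU
  have h1 := (h.comp hT).sub
    ((Complex.continuous_re.tendsto 0).comp (tendsto_integral_airyKernel_vertical ha))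
  have h2 := intervalIntegral_tendsto_integral_Ioi 0 (hint.const_mul (√3 * a)) tendsto_id
  simp only [id_eq, integral_cosh_mul_exp_neg_cosh_eq] at h2
  have h3 := tendsto_nhds_unique h1 h2
  rw [integral_const_mul, mul_assoc, hval, Complex.zero_re, sub_zero] at h3
  rw [h3]; ring

lemma integral_rpow_mul_exp_neg_cube {s b : ℝ} (hs : 0 < s) (hb : 0 < b) :
    IntegrableOn (fun x : ℝ => x ^ (s - 1) * Real.exp (-b * x ^ 3)) (Ioi 0) ∧
    ∫ x in Ioi (0 : ℝ), x ^ (s - 1) * Real.exp (-b * x ^ 3) =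
      b ^ (-(s / 3)) * (1 / 3) * Real.Gamma (s / 3) := by
  have h1 := integrableOn_rpow_mul_exp_neg_mul_rpow (p := 3) (s := s - 1) (b := b)
    (by linarith) (by norm_num) hb
  have h2 := integral_rpow_mul_exp_neg_mul_rpow (p := 3) (q := s - 1) (b := b)
    (by norm_num) (by linarith) hb
  have h3 : ∀ x : ℝ, x ^ (3 : ℝ) = x ^ 3 := fun x => by exact_mod_cast Real.rpow_natCast x 3
  simp only [h3] at h1 h2
  refine ⟨h1, h2.trans ?_⟩
  ring_nf

lemma integral_rpow_mul_integral_exp {s : ℝ} (hs : 0 < s) :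
    ∫ x in Ioi (0 : ℝ), x ^ (s - 1) *
        ∫ t in Ioi (0 : ℝ), Real.exp (-(t ^ 3 + x ^ 3 / t ^ 3) / 3) =
      (3 : ℝ) ^ ((2 * s + 1) / 3 - 2) * Real.Gamma ((s + 1) / 3) * Real.Gamma (s / 3) := by
  have hfac : ∀ x t : ℝ, x ^ (s - 1) * Real.exp (-(t ^ 3 + x ^ 3 / t ^ 3) / 3) =
      Real.exp (-(1 / 3) * t ^ 3) * (x ^ (s - 1) * Real.exp (-(1 / (3 * t ^ 3)) * x ^ 3)) := by
    intro x t
    rw [mul_left_comm, ← Real.exp_add]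
    congr 2
    ring
  have hinner : ∀ t ∈ Ioi (0 : ℝ),
      ∫ x in Ioi (0 : ℝ), x ^ (s - 1) * Real.exp (-(t ^ 3 + x ^ 3 / t ^ 3) / 3) =
      ((3 : ℝ) ^ (s / 3) * (1 / 3) * Real.Gamma (s / 3)) *
        (t ^ (s + 1 - 1) * Real.exp (-(1 / 3) * t ^ 3)) := by
    intro t ht
    have ht : 0 < t := ht
    simp only [hfac]
    rw [integral_const_mul, (integral_rpow_mul_exp_neg_cube hs (by positivity)).2]
    have : (1 / (3 * t ^ 3)) ^ (-(s / 3)) = (3 : ℝ) ^ (s / 3) * t ^ (s + 1 - 1) := by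
      rw [one_div, Real.inv_rpow (by positivity), Real.rpow_neg (by positivity), inv_inv,
        Real.mul_rpow (by norm_num) (by positivity), ← Real.rpow_natCast t 3,
        ← Real.rpow_mul ht.le]
      congr 2
      push_cast; ring
    rw [this]; ring
  obtain ⟨hint, hval⟩ := integral_rpow_mul_exp_neg_cube (s := s + 1) (b := 1 / 3)
    (by linarith) (by norm_num)
  simp only [← integral_const_mul]
  rw [integral_integral_swap, setIntegral_congr_fun measurableSet_Ioi hinner,
    integral_const_mul, hval]
  · have h1 : ((1 : ℝ) / 3) ^ (-((s + 1) / 3)) = 3 ^ ((s + 1) / 3) := by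
      rw [one_div, Real.inv_rpow (by norm_num), Real.rpow_neg (by norm_num), inv_inv]
    have h2 : (3 : ℝ) ^ ((2 * s + 1) / 3 - 2) =
        3 ^ (s / 3) * 3 ^ ((s + 1) / 3) * (1 / 9) := by
      rw [Real.rpow_sub (by norm_num), ← Real.rpow_add (by norm_num)]
      norm_num
      ring_nf
    rw [h1, h2]; ring
  · rw [integrable_prod_iff' (by
      apply Measurable.aestronglyMeasurable
      unfold Function.uncurry
      fun_prop)]
    simp only [Function.uncurry]
    constructor
    · filter_upwards [ae_restrict_mem measurableSet_Ioi] with t ht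
      have ht : 0 < t := ht
      simp only [hfac]
      exact (integral_rpow_mul_exp_neg_cube hs (by positivity)).1.const_mul _
    · refine (hint.const_mul ((3 : ℝ) ^ (s / 3) * (1 / 3) * Real.Gamma (s / 3))).congr ?_
      filter_upwards [ae_restrict_mem measurableSet_Ioi] with t ht
      rw [← hinner t ht]
      refine setIntegral_congr_fun measurableSet_Ioi fun x hx => ?_
      have hx : 0 < x := hx
      exact (Real.norm_of_nonneg (by positivity)).symm

theorem stmt_1 (Ai : ℝ → ℝ)
    (hAi : ∀ x ∈ Ioi (0:ℝ),
      Tendsto (fun T => ∫ t in (0:ℝ)..T, Real.cos (t ^ 3 / 3 + x * t))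
        atTop (nhds (Real.pi * Ai x)))
    (s : ℝ) (hs : 0 < s) :
    ∫ x in Ioi (0:ℝ), x ^ (s - 1) * Ai x =
      (1 / (2 * Real.pi)) * (3 : ℝ) ^ ((4 * s - 7) / 6) *
        Real.Gamma ((s + 1) / 3) * Real.Gamma (s / 3) := by
  have hpi := Real.pi_pos
  have hrep : ∀ x ∈ Ioi (0 : ℝ), x ^ (s - 1) * Ai x = √3 / (2 * Real.pi) * (x ^ (s - 1) *
      ∫ t in Ioi (0 : ℝ), Real.exp (-(t ^ 3 + x ^ 3 / t ^ 3) / 3)) := by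
    intro x hx
    have h := pi_mul_airy_eq hx (hAi x hx)
    rw [eq_div_of_mul_eq hpi.ne' ((mul_comm _ _).trans h)]
    ring
  rw [setIntegral_congr_fun measurableSet_Ioi hrep, integral_const_mul,
    integral_rpow_mul_integral_exp hs]
  have h3 : (3 : ℝ) ^ ((4 * s - 7) / 6) = √3 * 3 ^ ((2 * s + 1) / 3 - 2) := by
    rw [Real.sqrt_eq_rpow, ← Real.rpow_add (by norm_num)]
    congr 1
    ring
  rw [h3]
  ring
end

section
/- Let 0 < a < 1, let b be real with b < 2 and b < 1 + a, and let 0 < μ < 1. Then ∫_0^∞ e^{−μx} U(a,b;x) dx = (Γ(2−b)/((a−1) Γ(1+a−b))) · Σ_{n=0}^∞ [ (1)_n (2−b)_n / ((2−a)_n n!) ] μ^n + μ^{a−1} Γ(1−a) / (1−μ)^{1+a−b}. -/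
open MeasureTheory Set

/-- The Tricomi confluent hypergeometric function, defined by its integral
representation for `a > 0` and `x > 0`. -/
noncomputable def tricomiU (a b x : ℝ) : ℝ :=
  (1 / Real.Gamma a) *
    ∫ t in Ioi (0:ℝ), t ^ (a - 1) * Real.exp (-(x * t)) * (1 + t) ^ (b - a - 1)

/-- The Pochhammer symbol `(q)ₙ = q (q+1) ⋯ (q+n-1)`. -/
noncomputable def poch (q : ℝ) (n : ℕ) : ℝ := ∏ i ∈ Finset.range n, (q + (i : ℝ))

/-- A nonnegative function whose lower Lebesgue integral is finite is integrable, with that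
integral. -/
lemma integrable_and_integral_eq_of_lintegral {α : Type*} [MeasurableSpace α] {ν : Measure α}
    {f : α → ℝ} {v : ℝ} (hm : Measurable f) (h0 : 0 ≤ᵐ[ν] f) (hv : 0 ≤ v)
    (h : ∫⁻ x, ENNReal.ofReal (f x) ∂ν = ENNReal.ofReal v) :
    Integrable f ν ∧ ∫ x, f x ∂ν = v := by
  refine ⟨⟨hm.aestronglyMeasurable, ?_⟩, ?_⟩
  · rw [hasFiniteIntegral_iff_ofReal h0, h]
    exact ENNReal.ofReal_lt_top
  · rw [integral_eq_lintegral_of_nonneg_ae h0 hm.aestronglyMeasurable, h, ENNReal.toReal_ofReal hv]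

/-- Tonelli's theorem for iterated Bochner integrals of nonnegative functions. -/
lemma integral_integral_eq_of_lintegral_lintegral {s t : Set ℝ} (hs : MeasurableSet s)
    (ht : MeasurableSet t) {f : ℝ → ℝ → ℝ} {v : ℝ} (hm : Measurable (Function.uncurry f))
    (h0 : ∀ x ∈ s, ∀ y ∈ t, 0 ≤ f x y) (hv : 0 ≤ v)
    (h : ∫⁻ y in t, ∫⁻ x in s, ENNReal.ofReal (f x y) = ENNReal.ofReal v) :
    ∫ x in s, ∫ y in t, f x y = v := by
  have h0' : 0 ≤ᵐ[(volume.restrict s).prod (volume.restrict t)] Function.uncurry f := by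
    rw [Measure.prod_restrict]
    filter_upwards [ae_restrict_mem (hs.prod ht)] with p hp
    exact h0 _ hp.1 _ hp.2
  obtain ⟨hi, he⟩ := integrable_and_integral_eq_of_lintegral hm h0' hv (by
    rw [lintegral_prod_symm _ hm.ennreal_ofReal.aemeasurable]
    exact h)
  rw [← he, integral_prod _ hi]
  rfl

lemma lintegral_rpow_mul_exp_neg_mul_Ioi {a r : ℝ} (ha : 0 < a) (hr : 0 < r) :
    ∫⁻ t in Ioi (0:ℝ), ENNReal.ofReal (t ^ (a - 1) * Real.exp (-(r * t))) =
      ENNReal.ofReal (r ^ (-a) * Real.Gamma a) := by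
  have he := Real.integral_rpow_mul_exp_neg_mul_Ioi ha hr
  have hpos : 0 < (1 / r) ^ a * Real.Gamma a :=
    mul_pos (by positivity) (Real.Gamma_pos_of_pos ha)
  rw [← ofReal_integral_eq_lintegral_ofReal, he, one_div, Real.inv_rpow hr.le, Real.rpow_neg hr.le]
  · exact Integrable.of_integral_ne_zero (by rw [he]; exact hpos.ne')
  · filter_upwards [ae_restrict_mem measurableSet_Ioi] with t ht
    have : (0:ℝ) < t := ht
    simp only [Pi.zero_apply]
    positivity

/-- The beta integral on the half-line, with an affine base. -/
lemma lintegral_rpow_mul_add_mul_rpow_neg {a s A θ : ℝ} (ha : 0 < a) (has : a < s) (hA : 0 < A)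
    (hθ : 0 < θ) :
    ∫⁻ t in Ioi (0:ℝ), ENNReal.ofReal (t ^ (a - 1) * (A + θ * t) ^ (-s)) =
      ENNReal.ofReal (Real.Gamma a * Real.Gamma (s - a) / Real.Gamma s *
        (θ ^ (-a) * A ^ (a - s))) := by
  have hs : 0 < s := ha.trans has
  have hGs := Real.Gamma_pos_of_pos hs
  have hGa := Real.Gamma_pos_of_pos ha
  calc ∫⁻ t in Ioi (0:ℝ), ENNReal.ofReal (t ^ (a - 1) * (A + θ * t) ^ (-s))
      = ∫⁻ t in Ioi (0:ℝ), ∫⁻ x in Ioi (0:ℝ), ENNReal.ofReal (t ^ (a - 1) / Real.Gamma s *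
          (x ^ (s - 1) * Real.exp (-((A + θ * t) * x)))) := by
        refine setLIntegral_congr_fun measurableSet_Ioi fun t (ht : 0 < t) => ?_
        have h1 : 0 ≤ t ^ (a - 1) / Real.Gamma s := by positivity
        simp_rw [ENNReal.ofReal_mul h1]
        rw [lintegral_const_mul' _ _ ENNReal.ofReal_ne_top,
          lintegral_rpow_mul_exp_neg_mul_Ioi hs (by positivity), ← ENNReal.ofReal_mul h1]
        congr 1
        field_simp
    _ = ∫⁻ x in Ioi (0:ℝ), ∫⁻ t in Ioi (0:ℝ), ENNReal.ofReal (t ^ (a - 1) / Real.Gamma s *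
          (x ^ (s - 1) * Real.exp (-((A + θ * t) * x)))) :=
        lintegral_lintegral_swap (by unfold Function.uncurry; fun_prop)
    _ = ∫⁻ x in Ioi (0:ℝ), ENNReal.ofReal (Real.Gamma a / Real.Gamma s * θ ^ (-a)) *
          ENNReal.ofReal (x ^ (s - a - 1) * Real.exp (-(A * x))) := by
        refine setLIntegral_congr_fun measurableSet_Ioi fun x (hx : 0 < x) => ?_
        have h1 : 0 ≤ x ^ (s - 1) * Real.exp (-(A * x)) / Real.Gamma s := by positivity
        have h2 : ∀ t : ℝ, t ^ (a - 1) / Real.Gamma s *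
            (x ^ (s - 1) * Real.exp (-((A + θ * t) * x))) =
            x ^ (s - 1) * Real.exp (-(A * x)) / Real.Gamma s *
              (t ^ (a - 1) * Real.exp (-((θ * x) * t))) := fun t => by
          rw [show -((A + θ * t) * x) = -(A * x) + -((θ * x) * t) by ring, Real.exp_add]
          ring
        simp_rw [h2, ENNReal.ofReal_mul h1]
        rw [lintegral_const_mul' _ _ ENNReal.ofReal_ne_top,
          lintegral_rpow_mul_exp_neg_mul_Ioi ha (by positivity), ← ENNReal.ofReal_mul h1,
          ← ENNReal.ofReal_mul (by positivity), Real.mul_rpow hθ.le hx.le,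
          show s - a - 1 = (s - 1) + (-a) by ring, Real.rpow_add hx]
        congr 1
        ring
    _ = _ := by
        rw [lintegral_const_mul' _ _ ENNReal.ofReal_ne_top,
          lintegral_rpow_mul_exp_neg_mul_Ioi (by linarith) hA, ← ENNReal.ofReal_mul (by positivity),
          neg_sub]
        congr 1
        ring

/-- Euler's beta integral against a natural power, in terms of Pochhammer symbols. -/
lemma lintegral_rpow_neg_mul_one_sub_pow {a : ℝ} (ha1 : a < 1) (n : ℕ) :
    ∫⁻ θ in Ioo (0:ℝ) 1, ENNReal.ofReal (θ ^ (-a) * (1 - θ) ^ n) =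
      ENNReal.ofReal ((n.factorial : ℝ) / ((1 - a) * poch (2 - a) n)) := by
  have hα : 0 < 1 - a := by linarith
  have hβ : (0:ℝ) < n + 1 := by positivity
  have hB := ProbabilityTheory.beta_pos hα hβ
  have h := ProbabilityTheory.lintegral_betaPDF_eq_one hα hβ
  rw [ProbabilityTheory.lintegral_betaPDF] at h
  have hG : ∀ n : ℕ, Real.Gamma (2 - a + n) = (1 - a) * Real.Gamma (1 - a) * poch (2 - a) n := by
    intro n
    induction n with
    | zero =>
      rw [← Real.Gamma_add_one hα.ne']
      simp [poch]
      ring_nf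
    | succ k ih =>
      have hk : 0 < 2 - a + k := by have : (0:ℝ) ≤ k := k.cast_nonneg; linarith
      rw [Nat.cast_succ, ← add_assoc, Real.Gamma_add_one hk.ne', ih]
      simp only [poch, Finset.prod_range_succ]
      ring
  have hb : ProbabilityTheory.beta (1 - a) (n + 1) =
      (n.factorial : ℝ) / ((1 - a) * poch (2 - a) n) := by
    have := Real.Gamma_pos_of_pos hα
    rw [ProbabilityTheory.beta, Real.Gamma_nat_eq_factorial,
      show 1 - a + ((n:ℝ) + 1) = 2 - a + n by ring, hG]
    field_simp
  rw [← hb]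
  have h2 : ∀ θ : ℝ, 1 / ProbabilityTheory.beta (1 - a) (n + 1) * θ ^ (1 - a - 1) *
      (1 - θ) ^ ((n:ℝ) + 1 - 1) =
      1 / ProbabilityTheory.beta (1 - a) (n + 1) * (θ ^ (-a) * (1 - θ) ^ n) := fun θ => by
    rw [add_sub_cancel_right, Real.rpow_natCast, show 1 - a - 1 = -a by ring, mul_assoc]
  simp_rw [h2, ENNReal.ofReal_mul (one_div_pos.2 hB).le] at h
  rw [lintegral_const_mul' _ _ ENNReal.ofReal_ne_top] at h
  rw [one_div, ENNReal.ofReal_inv_of_pos hB] at h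
  rw [← ENNReal.mul_right_inj (a := (ENNReal.ofReal (ProbabilityTheory.beta (1 - a) (n + 1)))⁻¹), h,
    ENNReal.inv_mul_cancel]
  all_goals simp [hB]

lemma poch_one (n : ℕ) : poch 1 n = n.factorial := by
  rw [← Finset.prod_range_add_one_eq_factorial]
  push_cast
  simp [poch, add_comm]

lemma poch_pos {q : ℝ} (hq : 0 < q) (n : ℕ) : 0 < poch q n :=
  Finset.prod_pos fun _ _ => by positivity

/-- The binomial series for a negative real exponent. -/
lemma hasSum_poch_div_factorial_mul_pow {q x : ℝ} (hx : |x| < 1) :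
    HasSum (fun n : ℕ => poch q n / n.factorial * x ^ n) ((1 - x) ^ (-q)) := by
  have h := (Real.one_div_one_sub_rpow_hasFPowerSeriesOnBall_zero q).hasSum (y := x) (by
    simpa [← ofReal_norm] using hx)
  have hc : ∀ n : ℕ, Ring.choose (q + n - 1) n = poch q n / n.factorial := by
    intro n
    rw [Ring.choose_eq_smul, Polynomial.descPochhammer_smeval_eq_ascPochhammer,
      Polynomial.ascPochhammer_smeval_eq_eval]
    have : ∀ n : ℕ, (ascPochhammer ℝ n).eval q = poch q n := by
      intro n
      induction n with
      | zero => simp [poch]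
      | succ k ih => rw [ascPochhammer_succ_eval, ih]; simp [poch, Finset.prod_range_succ]
    rw [← this, show q + n - 1 - n + 1 = q by ring]
    simp [div_eq_inv_mul]
  have h1 : 0 ≤ 1 - x := by linarith [(abs_lt.1 hx).2]
  simpa [hc, Real.rpow_neg h1, mul_comm] using h

lemma summable_poch_div_poch_mul_pow {a q μ : ℝ} (ha1 : a < 1) (hq : 0 < q) (hμ0 : 0 < μ)
    (hμ1 : μ < 1) : Summable fun n : ℕ => poch q n / poch (2 - a) n * μ ^ n := by
  have h2 : 0 < 2 - a := by linarith
  refine Summable.of_nonneg_of_le (fun n => ?_) (fun n => ?_)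
    (hasSum_poch_div_factorial_mul_pow (q := q) (abs_lt.2 ⟨by linarith, hμ1⟩)).summable
  · have := poch_pos hq n
    have := poch_pos h2 n
    positivity
  · have := (poch_pos hq n).le
    have hle : (n.factorial : ℝ) ≤ poch (2 - a) n := by
      rw [← poch_one]
      exact Finset.prod_le_prod (fun _ _ => by positivity) fun _ _ => by linarith
    gcongr

/-- Euler's integral representation of the hypergeometric series `₂F₁(1, q; 2 - a; μ)`. -/
lemma lintegral_rpow_neg_mul_one_sub_mul_rpow_neg {a q μ : ℝ} (ha1 : a < 1) (hq : 0 < q)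
    (hμ0 : 0 < μ) (hμ1 : μ < 1) :
    ∫⁻ θ in Ioo (0:ℝ) 1, ENNReal.ofReal (θ ^ (-a) * (1 - μ * (1 - θ)) ^ (-q)) =
      ENNReal.ofReal ((1 - a)⁻¹ * ∑' n : ℕ, poch q n / poch (2 - a) n * μ ^ n) := by
  have h2 : 0 < 2 - a := by linarith
  have h1 : 0 < 1 - a := by linarith
  calc ∫⁻ θ in Ioo (0:ℝ) 1, ENNReal.ofReal (θ ^ (-a) * (1 - μ * (1 - θ)) ^ (-q))
      = ∫⁻ θ in Ioo (0:ℝ) 1, ∑' n : ℕ, ENNReal.ofReal (poch q n / n.factorial * μ ^ n) *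
          ENNReal.ofReal (θ ^ (-a) * (1 - θ) ^ n) := by
        refine setLIntegral_congr_fun measurableSet_Ioo fun θ hθ => ?_
        have hθ0 : 0 < θ := hθ.1
        have hθ1 : 0 < 1 - θ := sub_pos.2 hθ.2
        have hx : |μ * (1 - θ)| < 1 := by
          rw [abs_of_pos (by positivity)]
          nlinarith
        have hs := (hasSum_poch_div_factorial_mul_pow (q := q) hx).mul_left (θ ^ (-a))
        rw [← hs.tsum_eq, ENNReal.ofReal_tsum_of_nonneg _ hs.summable]
        · refine tsum_congr fun n => ?_
          have := poch_pos hq n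
          rw [← ENNReal.ofReal_mul (by positivity)]
          congr 1
          rw [mul_pow]
          ring
        · intro n
          have := poch_pos hq n
          positivity
    _ = ∑' n : ℕ, ENNReal.ofReal ((1 - a)⁻¹ * (poch q n / poch (2 - a) n * μ ^ n)) := by
        rw [lintegral_tsum fun n => by fun_prop]
        refine tsum_congr fun n => ?_
        have := poch_pos hq n
        have := poch_pos h2 n
        rw [lintegral_const_mul' _ _ ENNReal.ofReal_ne_top,
          lintegral_rpow_neg_mul_one_sub_pow ha1, ← ENNReal.ofReal_mul (by positivity)]
        congr 1
        field_simp
    _ = _ := by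
        have hs := (summable_poch_div_poch_mul_pow ha1 hq hμ0 hμ1).mul_left (1 - a)⁻¹
        rw [← tsum_mul_left, ENNReal.ofReal_tsum_of_nonneg _ hs]
        intro n
        have := poch_pos hq n
        have := poch_pos h2 n
        positivity

lemma lintegral_mul_add_mul_rpow_neg_sub_one {A c d : ℝ} (hA : 0 < A) (hc : 0 < c) (hd : 0 < d) :
    ∫⁻ θ in Ioo (0:ℝ) 1, ENNReal.ofReal (c * (A + θ * d) ^ (-c - 1)) =
      ENNReal.ofReal ((A ^ (-c) - (A + d) ^ (-c)) / d) := by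
  have hpos : ∀ θ ∈ Icc (0:ℝ) 1, 0 < A + θ * d := fun θ hθ => by
    have := mul_nonneg hθ.1 hd.le
    linarith
  have hcont : ContinuousOn (fun θ : ℝ => c * (A + θ * d) ^ (-c - 1)) (Icc 0 1) :=
    continuousOn_const.mul (ContinuousOn.rpow_const (by fun_prop) fun θ hθ => .inl (hpos θ hθ).ne')
  have hFTC : ∫ θ in (0:ℝ)..1, c * (A + θ * d) ^ (-c - 1) =
      (A ^ (-c) - (A + d) ^ (-c)) / d := by
    rw [intervalIntegral.integral_eq_sub_of_hasDerivAt
      (f := fun θ => -(A + θ * d) ^ (-c) / d)]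
    · simp only [one_mul, zero_mul, add_zero]
      ring
    · intro θ hθ
      rw [uIcc_of_le zero_le_one] at hθ
      have h1 : HasDerivAt (fun θ : ℝ => A + θ * d) (1 * d) θ :=
        ((hasDerivAt_id θ).mul_const d).const_add A
      have h2 := (h1.rpow_const (p := -c) (.inl (hpos θ hθ).ne')).neg.div_const d
      convert! h2 using 1
      field_simp
    · exact ContinuousOn.intervalIntegrable (by rwa [uIcc_of_le zero_le_one])
  rw [← hFTC, intervalIntegral.integral_of_le zero_le_one, integral_Ioc_eq_integral_Ioo,
    ofReal_integral_eq_lintegral_ofReal]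
  · exact (hcont.integrableOn_Icc).mono_set Ioo_subset_Icc_self
  · filter_upwards [ae_restrict_mem measurableSet_Ioo] with θ hθ
    have := hpos θ (Ioo_subset_Icc_self hθ)
    simp only [Pi.zero_apply]
    positivity

lemma lintegral_rpow_mul_sub_rpow_neg_div {a c μ : ℝ} (ha0 : 0 < a) (ha1 : a < 1) (hc : 0 < c)
    (hμ0 : 0 < μ) (hμ1 : μ < 1) :
    ∫⁻ t in Ioi (0:ℝ),
        ENNReal.ofReal (t ^ (a - 1) * (((1 - μ) ^ (-c) - (1 + t) ^ (-c)) / (t + μ))) =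
      ENNReal.ofReal (Real.Gamma a * Real.Gamma (c + 1 - a) / Real.Gamma c * ((1 - a)⁻¹ *
        ∑' n : ℕ, poch (c + 1 - a) n / poch (2 - a) n * μ ^ n)) := by
  have hGc := Real.Gamma_pos_of_pos hc
  have hGa := Real.Gamma_pos_of_pos ha0
  have hq : 0 < c + 1 - a := by linarith
  have hGq := Real.Gamma_pos_of_pos hq
  have hA : 0 < 1 - μ := by linarith
  calc ∫⁻ t in Ioi (0:ℝ),
        ENNReal.ofReal (t ^ (a - 1) * (((1 - μ) ^ (-c) - (1 + t) ^ (-c)) / (t + μ)))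
      = ∫⁻ t in Ioi (0:ℝ), ∫⁻ θ in Ioo (0:ℝ) 1,
          ENNReal.ofReal (t ^ (a - 1) * (c * (1 - μ + θ * (t + μ)) ^ (-c - 1))) := by
        refine setLIntegral_congr_fun measurableSet_Ioi fun t (ht : 0 < t) => ?_
        have h1 : 0 ≤ t ^ (a - 1) := by positivity
        simp_rw [ENNReal.ofReal_mul h1]
        rw [lintegral_const_mul' _ _ ENNReal.ofReal_ne_top,
          lintegral_mul_add_mul_rpow_neg_sub_one hA hc (by positivity),
          show 1 - μ + (t + μ) = 1 + t by ring]
    _ = ∫⁻ θ in Ioo (0:ℝ) 1, ∫⁻ t in Ioi (0:ℝ),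
          ENNReal.ofReal (t ^ (a - 1) * (c * (1 - μ + θ * (t + μ)) ^ (-c - 1))) :=
        lintegral_lintegral_swap (by unfold Function.uncurry; fun_prop)
    _ = ∫⁻ θ in Ioo (0:ℝ) 1,
          ENNReal.ofReal (Real.Gamma a * Real.Gamma (c + 1 - a) / Real.Gamma c) *
            ENNReal.ofReal (θ ^ (-a) * (1 - μ * (1 - θ)) ^ (-(c + 1 - a))) := by
        refine setLIntegral_congr_fun measurableSet_Ioo fun θ hθ => ?_
        have hθ0 : 0 < θ := hθ.1
        have hθ1 : 0 < 1 - θ := sub_pos.2 hθ.2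
        have h2 : ∀ t : ℝ, t ^ (a - 1) * (c * (1 - μ + θ * (t + μ)) ^ (-c - 1)) =
            c * (t ^ (a - 1) * (1 - μ * (1 - θ) + θ * t) ^ (-(c + 1))) := fun t => by
          rw [show 1 - μ + θ * (t + μ) = 1 - μ * (1 - θ) + θ * t by ring, neg_add']
          ring
        simp_rw [h2, ENNReal.ofReal_mul hc.le]
        rw [lintegral_const_mul' _ _ ENNReal.ofReal_ne_top,
          lintegral_rpow_mul_add_mul_rpow_neg ha0 (by linarith) (by nlinarith) hθ0,
          ← ENNReal.ofReal_mul hc.le, ← ENNReal.ofReal_mul (by positivity),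
          Real.Gamma_add_one hc.ne', neg_sub]
        congr 1
        field_simp
    _ = _ := by
        rw [lintegral_const_mul' _ _ ENNReal.ofReal_ne_top,
          lintegral_rpow_neg_mul_one_sub_mul_rpow_neg ha1 hq hμ0 hμ1,
          ← ENNReal.ofReal_mul (by positivity)]

/-- The Stieltjes-type integral to which the Laplace transform of `tricomiU` reduces. -/
lemma integrable_and_integral_rpow_mul_rpow_neg_div {a c μ : ℝ} (ha0 : 0 < a) (ha1 : a < 1)
    (hc : 0 < c) (hμ0 : 0 < μ) (hμ1 : μ < 1) :
    IntegrableOn (fun t : ℝ => t ^ (a - 1) * (1 + t) ^ (-c) / (t + μ)) (Ioi 0) ∧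
      ∫ t in Ioi (0:ℝ), t ^ (a - 1) * (1 + t) ^ (-c) / (t + μ) =
        (1 - μ) ^ (-c) * (Real.Gamma a * Real.Gamma (1 - a) * μ ^ (a - 1)) -
          Real.Gamma a * Real.Gamma (c + 1 - a) / Real.Gamma c * ((1 - a)⁻¹ *
            ∑' n : ℕ, poch (c + 1 - a) n / poch (2 - a) n * μ ^ n) := by
  have hGc := Real.Gamma_pos_of_pos hc
  have hGa := Real.Gamma_pos_of_pos ha0
  have hq : 0 < c + 1 - a := by linarith
  have h1a : 0 < 1 - a := by linarith
  have h2a : 0 < 2 - a := by linarith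
  have hGq := Real.Gamma_pos_of_pos hq
  have hG1a := Real.Gamma_pos_of_pos h1a
  have hA : 0 < 1 - μ := by linarith
  have hS : 0 ≤ ∑' n : ℕ, poch (c + 1 - a) n / poch (2 - a) n * μ ^ n := tsum_nonneg fun n => by
    have := poch_pos hq n
    have := poch_pos h2a n
    positivity
  obtain ⟨hi, he⟩ := integrable_and_integral_eq_of_lintegral (by fun_prop) (by
    filter_upwards [ae_restrict_mem measurableSet_Ioi] with t (ht : 0 < t)
    have : 0 ≤ (1 - μ) ^ (-c) - (1 + t) ^ (-c) :=
      sub_nonneg.2 (Real.rpow_le_rpow_of_nonpos hA (by linarith) (by linarith))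
    simp only [Pi.zero_apply]
    positivity) (by positivity) (lintegral_rpow_mul_sub_rpow_neg_div ha0 ha1 hc hμ0 hμ1)
  obtain ⟨hi', he'⟩ := integrable_and_integral_eq_of_lintegral (by fun_prop) (by
    filter_upwards [ae_restrict_mem measurableSet_Ioi] with t (ht : 0 < t)
    simp only [Pi.zero_apply]
    positivity) (by simp only [Real.Gamma_one]; positivity)
    (lintegral_rpow_mul_add_mul_rpow_neg ha0 ha1 hμ0 one_pos)
  have hK : EqOn (fun t : ℝ => (1 - μ) ^ (-c) * (t ^ (a - 1) * (μ + 1 * t) ^ (-1 : ℝ)) -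
      t ^ (a - 1) * (((1 - μ) ^ (-c) - (1 + t) ^ (-c)) / (t + μ)))
      (fun t : ℝ => t ^ (a - 1) * (1 + t) ^ (-c) / (t + μ)) (Ioi 0) := fun t ht => by
    have : 0 < t := ht
    simp only [one_mul, add_comm μ, Real.rpow_neg_one]
    field_simp
    ring
  refine ⟨IntegrableOn.congr_fun ((hi'.const_mul _).sub hi) hK measurableSet_Ioi, ?_⟩
  rw [← setIntegral_congr_fun measurableSet_Ioi hK, integral_sub (hi'.const_mul _) hi,
    integral_const_mul, he, he']
  simp

theorem stmt_2 (a b μ : ℝ) (ha0 : 0 < a) (ha1 : a < 1) (hb2 : b < 2) (hba : b < 1 + a)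
    (hμ0 : 0 < μ) (hμ1 : μ < 1) :
    ∫ x in Ioi (0:ℝ), Real.exp (-(μ * x)) * tricomiU a b x =
      (Real.Gamma (2 - b) / ((a - 1) * Real.Gamma (1 + a - b))) *
        ∑' n : ℕ, (poch 1 n * poch (2 - b) n / (poch (2 - a) n * (n.factorial : ℝ))) * μ ^ n
      + μ ^ (a - 1) * Real.Gamma (1 - a) / (1 - μ) ^ (1 + a - b) := by
  have hc : 0 < 1 + a - b := by linarith
  have hGa := Real.Gamma_pos_of_pos ha0
  have hGc := Real.Gamma_pos_of_pos hc
  have hA : 0 < 1 - μ := by linarith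
  obtain ⟨hi, he⟩ := integrable_and_integral_rpow_mul_rpow_neg_div ha0 ha1 hc hμ0 hμ1
  have h0 : ∀ t ∈ Ioi (0:ℝ), 0 ≤ t ^ (a - 1) * (1 + t) ^ (-(1 + a - b)) / (t + μ) :=
    fun t (ht : 0 < t) => by positivity
  have hswap : ∫ x in Ioi (0:ℝ), ∫ t in Ioi (0:ℝ), Real.exp (-(μ * x)) *
      (t ^ (a - 1) * Real.exp (-(x * t)) * (1 + t) ^ (b - a - 1)) =
      ∫ t in Ioi (0:ℝ), t ^ (a - 1) * (1 + t) ^ (-(1 + a - b)) / (t + μ) := by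
    refine integral_integral_eq_of_lintegral_lintegral measurableSet_Ioi measurableSet_Ioi
      (by unfold Function.uncurry; fun_prop) (fun x _ t (ht : 0 < t) => by positivity)
      (setIntegral_nonneg measurableSet_Ioi h0) ?_
    rw [ofReal_integral_eq_lintegral_ofReal hi (ae_restrict_of_forall_mem measurableSet_Ioi h0)]
    refine setLIntegral_congr_fun measurableSet_Ioi fun t (ht : 0 < t) => ?_
    have h1 : 0 ≤ t ^ (a - 1) * (1 + t) ^ (b - a - 1) := by positivity
    have h2 : ∀ x : ℝ, Real.exp (-(μ * x)) *
        (t ^ (a - 1) * Real.exp (-(x * t)) * (1 + t) ^ (b - a - 1)) =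
        t ^ (a - 1) * (1 + t) ^ (b - a - 1) *
          (x ^ ((1:ℝ) - 1) * Real.exp (-((t + μ) * x))) := fun x => by
      rw [show -((t + μ) * x) = -(μ * x) + -(x * t) by ring, Real.exp_add, sub_self,
        Real.rpow_zero]
      ring
    simp_rw [h2, ENNReal.ofReal_mul h1]
    rw [lintegral_const_mul' _ _ ENNReal.ofReal_ne_top,
      lintegral_rpow_mul_exp_neg_mul_Ioi one_pos (by positivity), ← ENNReal.ofReal_mul h1,
      Real.Gamma_one, Real.rpow_neg_one, show -(1 + a - b) = b - a - 1 by ring]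
    congr 1
    ring
  have hsum : ∑' n : ℕ, (poch 1 n * poch (2 - b) n / (poch (2 - a) n * (n.factorial : ℝ))) * μ ^ n =
      ∑' n : ℕ, poch (2 - b) n / poch (2 - a) n * μ ^ n := tsum_congr fun n => by
    rw [poch_one]
    field_simp
  simp_rw [integral_const_mul] at hswap
  simp only [tricomiU, mul_left_comm _ (1 / Real.Gamma a)]
  rw [integral_const_mul, hswap, he, hsum, show 1 + a - b + 1 - a = 2 - b by ring,
    Real.rpow_neg hA.le]
  have h1 : 1 - a ≠ 0 := by linarith
  have h2 : a - 1 ≠ 0 := by linarith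
  have h3 := Real.rpow_pos_of_pos hA (1 + a - b)
  rw [← neg_sub a 1, inv_neg]
  field_simp
  ring
end

section
/- ∫_0^∞ K₀(x) dx = π/2. -/
open MeasureTheory Filter Set

/-- The truncated cosine integral whose limit as `T → ∞` is the Bessel function `K₀`. -/
noncomputable def truncatedBesselK (T x : ℝ) : ℝ :=
  ∫ t in (0:ℝ)..T, Real.cos (x * t) / Real.sqrt (t ^ 2 + 1)

lemma abs_intervalIntegral_le_integral {F g : ℝ → ℝ} {T : ℝ} (hT : 0 ≤ T)
    (hg : Integrable g) (hg0 : ∀ t, 0 ≤ g t) (hF : ∀ t, 0 < t → |F t| ≤ g t) :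
    |∫ t in (0:ℝ)..T, F t| ≤ ∫ t, g t := by
  have h1 : ‖∫ t in (0:ℝ)..T, F t‖ ≤ ∫ t in (0:ℝ)..T, g t :=
    intervalIntegral.norm_integral_le_of_norm_le hT
      (Eventually.of_forall fun t ht => hF t ht.1) hg.intervalIntegrable
  refine h1.trans ?_
  rw [intervalIntegral.integral_of_le hT]
  exact setIntegral_le_integral hg (Eventually.of_forall hg0)

lemma sqrt_sq_add_one_pos (t : ℝ) : 0 < Real.sqrt (t ^ 2 + 1) := by positivity

lemma sq_sqrt_sq_add_one (t : ℝ) : Real.sqrt (t ^ 2 + 1) ^ 2 = t ^ 2 + 1 :=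
  Real.sq_sqrt (by positivity)

lemma one_le_sqrt_sq_add_one (t : ℝ) : 1 ≤ Real.sqrt (t ^ 2 + 1) :=
  Real.one_le_sqrt.2 (by nlinarith [sq_nonneg t])

lemma le_sqrt_sq_add_one (t : ℝ) : t ≤ Real.sqrt (t ^ 2 + 1) :=
  Real.le_sqrt_of_sq_le (by linarith)

lemma hasDerivAt_sqrt_sq_add_one (t : ℝ) :
    HasDerivAt (fun t => Real.sqrt (t ^ 2 + 1)) (t / Real.sqrt (t ^ 2 + 1)) t := by
  refine (((hasDerivAt_pow 2 t).add_const 1).sqrt (by positivity)).congr_deriv ?_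
  have := (sqrt_sq_add_one_pos t).ne'
  field_simp
  simp

lemma truncatedBesselK_eq_add {x : ℝ} (hx : 0 < x) (T : ℝ) :
    truncatedBesselK T x = Real.sin (x * T) / (x * Real.sqrt (T ^ 2 + 1)) +
      (1 / x) * ∫ t in (0:ℝ)..T, Real.sin (x * t) * (t / Real.sqrt (t ^ 2 + 1) ^ 3) := by
  have hr := fun t => (sqrt_sq_add_one_pos t).ne'
  have hd : ∀ t ∈ uIcc 0 T, HasDerivAt
      (fun t => Real.sin (x * t) / (x * Real.sqrt (t ^ 2 + 1)))
      (Real.cos (x * t) / Real.sqrt (t ^ 2 + 1) -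
        (1 / x) * (Real.sin (x * t) * (t / Real.sqrt (t ^ 2 + 1) ^ 3))) t := by
    intro t _
    have h1 : HasDerivAt (fun t => Real.sin (x * t)) (Real.cos (x * t) * x) t := by
      simpa using ((hasDerivAt_id t).const_mul x).sin
    refine (h1.div ((hasDerivAt_sqrt_sq_add_one t).const_mul x)
      (mul_ne_zero hx.ne' (hr t))).congr_deriv ?_
    have := hr t
    field_simp
  have hc1 : Continuous fun t => Real.cos (x * t) / Real.sqrt (t ^ 2 + 1) :=
    (by fun_prop : Continuous _).div (by fun_prop) hr
  have hc2 : Continuous fun t => Real.sin (x * t) * (t / Real.sqrt (t ^ 2 + 1) ^ 3) :=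
    (by fun_prop : Continuous _).mul
      (continuous_id.div (by fun_prop) fun t => pow_ne_zero 3 (hr t))
  have h := intervalIntegral.integral_eq_sub_of_hasDerivAt hd
    ((hc1.sub (continuous_const.mul hc2)).intervalIntegrable _ _)
  rw [intervalIntegral.integral_sub (hc1.intervalIntegrable _ _)
    ((hc2.intervalIntegrable _ _).const_mul _),
    intervalIntegral.integral_const_mul] at h
  simp only [mul_zero, Real.sin_zero, zero_div, sub_zero] at h
  rw [truncatedBesselK]
  linarith

lemma integral_sin_mul_eq {x : ℝ} (hx : 0 < x) (T : ℝ) :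
    ∫ t in (0:ℝ)..T, Real.sin (x * t) * (t / Real.sqrt (t ^ 2 + 1) ^ 3) =
      (1 / x) * (-(Real.cos (x * T) * (T / Real.sqrt (T ^ 2 + 1) ^ 3)) +
        ∫ t in (0:ℝ)..T, Real.cos (x * t) *
          ((1 - 2 * t ^ 2) / Real.sqrt (t ^ 2 + 1) ^ 5)) := by
  have hr := fun t => (sqrt_sq_add_one_pos t).ne'
  have hd : ∀ t ∈ uIcc 0 T, HasDerivAt
      (fun t => -(Real.cos (x * t) * (t / Real.sqrt (t ^ 2 + 1) ^ 3)))
      (x * (Real.sin (x * t) * (t / Real.sqrt (t ^ 2 + 1) ^ 3)) -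
        Real.cos (x * t) * ((1 - 2 * t ^ 2) / Real.sqrt (t ^ 2 + 1) ^ 5)) t := by
    intro t _
    have h1 : HasDerivAt (fun t => Real.cos (x * t)) (-Real.sin (x * t) * x) t := by
      simpa using ((hasDerivAt_id t).const_mul x).cos
    have h2 : HasDerivAt (fun t => t / Real.sqrt (t ^ 2 + 1) ^ 3)
        ((1 - 2 * t ^ 2) / Real.sqrt (t ^ 2 + 1) ^ 5) t := by
      refine ((hasDerivAt_id t).div ((hasDerivAt_sqrt_sq_add_one t).pow 3)
        (pow_ne_zero 3 (hr t))).congr_deriv ?_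
      have h3 := hr t
      have h4 := sq_sqrt_sq_add_one t
      simp only [id, Pi.pow_apply]
      generalize Real.sqrt (t ^ 2 + 1) = r at *
      have : t ^ 2 = r ^ 2 - 1 := by linarith
      field_simp
      push_cast
      rw [this]
      ring
    refine (h1.mul h2).neg.congr_deriv ?_
    ring
  have hc1 : Continuous fun t => Real.sin (x * t) * (t / Real.sqrt (t ^ 2 + 1) ^ 3) :=
    (by fun_prop : Continuous _).mul
      (continuous_id.div (by fun_prop) fun t => pow_ne_zero 3 (hr t))
  have hc2 : Continuous fun t =>
      Real.cos (x * t) * ((1 - 2 * t ^ 2) / Real.sqrt (t ^ 2 + 1) ^ 5) :=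
    (by fun_prop : Continuous _).mul
      ((by fun_prop : Continuous _).div (by fun_prop) fun t => pow_ne_zero 5 (hr t))
  have h := intervalIntegral.integral_eq_sub_of_hasDerivAt hd
    (((continuous_const.mul hc1).sub hc2).intervalIntegrable _ _)
  rw [intervalIntegral.integral_sub ((hc1.intervalIntegrable _ _).const_mul _)
    (hc2.intervalIntegrable _ _), intervalIntegral.integral_const_mul] at h
  simp only [zero_div, mul_zero, neg_zero, sub_zero] at h
  rw [one_div, eq_inv_mul_iff_mul_eq₀ hx.ne']
  linarith

lemma abs_sin_le_sqrt {y : ℝ} (hy : 0 ≤ y) : |Real.sin y| ≤ Real.sqrt y := by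
  apply Real.le_sqrt_of_sq_le
  have h1 := Real.abs_sin_le_one y
  have h2 : |Real.sin y| ≤ y := by simpa [abs_of_nonneg hy] using Real.abs_sin_le_abs (x := y)
  nlinarith [abs_nonneg (Real.sin y)]

/-- A bound, uniform in the truncation, that is integrable near `0`. -/
lemma exists_abs_truncatedBesselK_le_inv_sqrt :
    ∃ C, ∀ T x, 0 < T → 0 < x → |truncatedBesselK T x| ≤ C * (Real.sqrt x)⁻¹ := by
  have hint : Integrable fun t : ℝ => (1 + ‖t‖ ^ 2) ^ (-(3 / 2 : ℝ) / 2) :=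
    integrable_rpow_neg_one_add_norm_sq (by simp; norm_num)
  refine ⟨1 + ∫ t : ℝ, (1 + ‖t‖ ^ 2) ^ (-(3 / 2 : ℝ) / 2), ?_⟩
  intro T x hT hx
  have hsx : 0 < Real.sqrt x := Real.sqrt_pos.2 hx
  have hxx : Real.sqrt x * Real.sqrt x = x := Real.mul_self_sqrt hx.le
  have hbd : |Real.sin (x * T) / (x * Real.sqrt (T ^ 2 + 1))| ≤ (Real.sqrt x)⁻¹ := by
    have hr := sqrt_sq_add_one_pos T
    rw [abs_div, abs_of_pos (mul_pos hx hr), div_le_iff₀ (mul_pos hx hr)]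
    refine (abs_sin_le_sqrt (by positivity)).trans ?_
    have h1 : Real.sqrt T ≤ Real.sqrt (T ^ 2 + 1) :=
      Real.sqrt_le_sqrt (by nlinarith [sq_nonneg (T - 1)])
    rw [Real.sqrt_mul hx.le]
    calc Real.sqrt x * Real.sqrt T ≤ Real.sqrt x * Real.sqrt (T ^ 2 + 1) := by gcongr
      _ = (Real.sqrt x)⁻¹ * ((Real.sqrt x * Real.sqrt x) * Real.sqrt (T ^ 2 + 1)) := by
        field_simp
      _ = _ := by rw [hxx]
  have hi : |∫ t in (0:ℝ)..T, Real.sin (x * t) * (t / Real.sqrt (t ^ 2 + 1) ^ 3)| ≤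
      Real.sqrt x * ∫ t : ℝ, (1 + ‖t‖ ^ 2) ^ (-(3 / 2 : ℝ) / 2) := by
    rw [← integral_const_mul]
    refine abs_intervalIntegral_le_integral hT.le (hint.const_mul _)
      (fun t => by positivity) fun t ht => ?_
    have hr := sqrt_sq_add_one_pos t
    rw [abs_mul, abs_of_nonneg (by positivity : 0 ≤ t / Real.sqrt (t ^ 2 + 1) ^ 3)]
    have h1 : |Real.sin (x * t)| ≤ Real.sqrt x * Real.sqrt (Real.sqrt (t ^ 2 + 1)) := by
      refine (abs_sin_le_sqrt (by positivity)).trans ?_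
      rw [Real.sqrt_mul hx.le]
      gcongr
      exact le_sqrt_sq_add_one t
    have h2 : (1 + ‖t‖ ^ 2) ^ (-(3 / 2 : ℝ) / 2) =
        Real.sqrt (Real.sqrt (t ^ 2 + 1)) *
          (Real.sqrt (t ^ 2 + 1) / Real.sqrt (t ^ 2 + 1) ^ 3) := by
      have e : (1 + ‖t‖ ^ 2) = Real.sqrt (t ^ 2 + 1) ^ (2 : ℝ) := by
        rw [Real.rpow_two, sq_sqrt_sq_add_one, Real.norm_eq_abs, sq_abs, add_comm]
      rw [e]
      generalize Real.sqrt (t ^ 2 + 1) = r at *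
      rw [← Real.rpow_mul hr.le, Real.sqrt_eq_rpow, ← Real.rpow_natCast]
      nth_rewrite 3 [← Real.rpow_one r]
      rw [← Real.rpow_sub hr, ← Real.rpow_add hr]
      norm_num
    rw [h2, ← mul_assoc]
    gcongr
    exact le_sqrt_sq_add_one t
  rw [truncatedBesselK_eq_add hx]
  refine (abs_add_le _ _).trans ?_
  rw [add_mul, one_mul]
  refine add_le_add hbd ?_
  rw [abs_mul, abs_of_pos (by positivity)]
  calc _ ≤ 1 / x * (Real.sqrt x * ∫ t : ℝ, (1 + ‖t‖ ^ 2) ^ (-(3 / 2 : ℝ) / 2)) := by gcongr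
    _ = _ := by
      nth_rewrite 1 [← hxx]
      field_simp

/-- A bound whose second term is integrable near infinity. -/
lemma abs_truncatedBesselK_le {T x : ℝ} (hT : 0 < T) (hx : 0 < x) :
    |truncatedBesselK T x| ≤ 1 / (x * T) + (1 + 2 * Real.pi) / x ^ 2 := by
  have hr := sqrt_sq_add_one_pos T
  have hb1 : |Real.sin (x * T) / (x * Real.sqrt (T ^ 2 + 1))| ≤ 1 / (x * T) := by
    rw [abs_div, abs_of_pos (mul_pos hx hr)]
    gcongr
    · exact Real.abs_sin_le_one _
    · exact le_sqrt_sq_add_one T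
  have hb2 : |-(Real.cos (x * T) * (T / Real.sqrt (T ^ 2 + 1) ^ 3))| ≤ 1 := by
    rw [abs_neg, abs_mul, abs_of_nonneg (by positivity : 0 ≤ T / Real.sqrt (T ^ 2 + 1) ^ 3)]
    refine mul_le_one₀ (Real.abs_cos_le_one _) (by positivity) ?_
    rw [div_le_one (by positivity)]
    exact (le_sqrt_sq_add_one T).trans (le_self_pow₀ (one_le_sqrt_sq_add_one T) (by norm_num))
  have hb3 : |∫ t in (0:ℝ)..T, Real.cos (x * t) *
      ((1 - 2 * t ^ 2) / Real.sqrt (t ^ 2 + 1) ^ 5)| ≤ 2 * Real.pi := by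
    rw [← integral_univ_inv_one_add_sq, ← integral_const_mul]
    refine abs_intervalIntegral_le_integral hT.le (integrable_inv_one_add_sq.const_mul _)
      (fun t => by positivity) fun t ht => ?_
    have hr := sqrt_sq_add_one_pos t
    rw [abs_mul, abs_div, abs_of_pos (pow_pos hr 5)]
    have h1 : |1 - 2 * t ^ 2| ≤ 2 * (t ^ 2 + 1) := by
      rw [abs_le]; constructor <;> nlinarith [sq_nonneg t]
    have h2 : (t ^ 2 + 1) ^ 2 ≤ Real.sqrt (t ^ 2 + 1) ^ 5 := by
      rw [← sq_sqrt_sq_add_one, ← pow_mul]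
      simp only [Real.sqrt_sq hr.le]
      exact pow_le_pow_right₀ (one_le_sqrt_sq_add_one t) (by norm_num)
    calc _ ≤ 1 * (2 * (t ^ 2 + 1) / (t ^ 2 + 1) ^ 2) := by
          gcongr
          exact Real.abs_cos_le_one _
      _ = _ := by
        have : t ^ 2 + 1 ≠ 0 := by positivity
        rw [add_comm 1 (t ^ 2)]
        field_simp
  rw [truncatedBesselK_eq_add hx, integral_sin_mul_eq hx]
  refine (abs_add_le _ _).trans (add_le_add hb1 ?_)
  rw [← mul_assoc, abs_mul, abs_of_pos (by positivity)]
  calc _ ≤ 1 / x * (1 / x) * (1 + 2 * Real.pi) := by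
        gcongr
        exact (abs_add_le _ _).trans (add_le_add hb2 hb3)
    _ = _ := by field_simp

/-- The damped truncations are dominated by a single integrable function. -/
lemma exists_integrableOn_bound_exp_mul_truncatedBesselK :
    ∃ g : ℝ → ℝ, IntegrableOn g (Ioi 0) ∧ ∀ T x, 0 < T → 0 < x →
      |Real.exp (-(T⁻¹ * x)) * truncatedBesselK T x| ≤ g x := by
  obtain ⟨C, hb⟩ := exists_abs_truncatedBesselK_le_inv_sqrt
  refine ⟨fun x => if x ≤ 1 then C * x ^ (-(1 / 2) : ℝ)
    else (2 + 2 * Real.pi) * x ^ (-2 : ℝ), ?_, ?_⟩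
  · rw [← Ioc_union_Ioi_eq_Ioi zero_le_one]
    refine IntegrableOn.union ?_ ?_
    · have h : IntegrableOn (fun x : ℝ => C * x ^ (-(1 / 2) : ℝ)) (Ioc 0 1) :=
        (((intervalIntegrable_iff_integrableOn_Ioc_of_le zero_le_one).1
          (intervalIntegral.intervalIntegrable_rpow' (by norm_num))).const_mul C)
      exact h.congr_fun (fun x hx => (if_pos hx.2).symm) measurableSet_Ioc
    · have h : IntegrableOn (fun x : ℝ => (2 + 2 * Real.pi) * x ^ (-2 : ℝ)) (Ioi 1) :=
        (integrableOn_Ioi_rpow_of_lt (by norm_num) one_pos).const_mul _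
      exact h.congr_fun (fun x hx => (if_neg (not_le.2 hx)).symm)
        measurableSet_Ioi
  · intro T x hT hx
    have hle : Real.exp (-(T⁻¹ * x)) ≤ 1 := Real.exp_le_one_iff.2 (by simp; positivity)
    beta_reduce
    rw [abs_mul, abs_of_pos (Real.exp_pos _)]
    by_cases h : x ≤ 1
    · rw [if_pos h, Real.rpow_neg hx.le, ← Real.sqrt_eq_rpow]
      exact (mul_le_of_le_one_left (abs_nonneg _) hle).trans (hb T x hT hx)
    · rw [if_neg h]
      have h1 : Real.exp (-(T⁻¹ * x)) * (1 / (x * T)) ≤ 1 / x ^ 2 := by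
        have h2 : T⁻¹ * x ≤ Real.exp (T⁻¹ * x) := by
          linarith [Real.add_one_le_exp (T⁻¹ * x)]
        have h3 : Real.exp (-(T⁻¹ * x)) * (T⁻¹ * x) ≤ 1 := by
          rw [Real.exp_neg, inv_mul_le_one₀ (Real.exp_pos _)]
          exact h2
        calc _ = (Real.exp (-(T⁻¹ * x)) * (T⁻¹ * x)) * (1 / x ^ 2) := by field_simp
          _ ≤ _ := mul_le_of_le_one_left (by positivity) h3
      calc _ ≤ Real.exp (-(T⁻¹ * x)) * (1 / (x * T) + (1 + 2 * Real.pi) / x ^ 2) := by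
            gcongr
            exact abs_truncatedBesselK_le hT hx
        _ ≤ 1 / x ^ 2 + (1 + 2 * Real.pi) / x ^ 2 := by
            rw [mul_add]
            exact add_le_add h1 (mul_le_of_le_one_left (by positivity) hle)
        _ = _ := by
          rw [Real.rpow_neg hx.le, Real.rpow_two]
          ring

lemma integral_exp_neg_mul_cos {d : ℝ} (hd : 0 < d) (t : ℝ) :
    ∫ x in Ioi (0:ℝ), Real.exp (-(d * x)) * Real.cos (x * t) = d / (d ^ 2 + t ^ 2) := by
  have hp : 0 < d ^ 2 + t ^ 2 := by positivity
  have hexp : IntegrableOn (fun x => Real.exp (-(d * x))) (Ioi 0) := by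
    simpa [neg_mul] using exp_neg_integrableOn_Ioi 0 hd
  have hint : IntegrableOn (fun x => Real.exp (-(d * x)) * Real.cos (x * t)) (Ioi 0) := by
    refine hexp.mono' (by fun_prop) (Eventually.of_forall fun x => ?_)
    rw [Real.norm_eq_abs, abs_mul, abs_of_pos (Real.exp_pos _)]
    exact mul_le_of_le_one_right (Real.exp_pos _).le (Real.abs_cos_le_one _)
  have hder : ∀ x ∈ Ici (0:ℝ), HasDerivAt
      (fun x => Real.exp (-(d * x)) * ((t * Real.sin (x * t) - d * Real.cos (x * t)) /
        (d ^ 2 + t ^ 2))) (Real.exp (-(d * x)) * Real.cos (x * t)) x := by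
    intro x _
    have h1 : HasDerivAt (fun x => Real.exp (-(d * x))) (Real.exp (-(d * x)) * -d) x := by
      simpa using ((hasDerivAt_id x).const_mul d).neg.exp
    have h2 : HasDerivAt (fun x => Real.sin (x * t)) (Real.cos (x * t) * t) x := by
      simpa using ((hasDerivAt_id x).mul_const t).sin
    have h3 : HasDerivAt (fun x => Real.cos (x * t)) (-Real.sin (x * t) * t) x := by
      simpa using ((hasDerivAt_id x).mul_const t).cos
    refine (h1.mul (((h2.const_mul t).sub (h3.const_mul d)).div_const
      (d ^ 2 + t ^ 2))).congr_deriv ?_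
    simp only [Pi.sub_apply]
    field_simp
    ring
  have hlim : Tendsto (fun x => Real.exp (-(d * x)) *
      ((t * Real.sin (x * t) - d * Real.cos (x * t)) / (d ^ 2 + t ^ 2))) atTop (nhds 0) := by
    have he : Tendsto (fun x => Real.exp (-(d * x))) atTop (nhds 0) :=
      Real.tendsto_exp_neg_atTop_nhds_zero.comp (tendsto_id.const_mul_atTop hd)
    refine he.zero_mul_isBoundedUnder_le
      (isBoundedUnder_of ⟨(|t| + |d|) / (d ^ 2 + t ^ 2), fun x => ?_⟩)
    simp only [Function.comp, Real.norm_eq_abs]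
    rw [abs_div, abs_of_pos hp]
    gcongr
    refine (abs_sub _ _).trans ?_
    rw [abs_mul, abs_mul]
    exact add_le_add (mul_le_of_le_one_right (abs_nonneg _) (Real.abs_sin_le_one _))
      (mul_le_of_le_one_right (abs_nonneg _) (Real.abs_cos_le_one _))
  rw [integral_Ioi_of_hasDerivAt_of_tendsto' hder hint hlim]
  simp
  ring

lemma integral_exp_mul_truncatedBesselK {d T : ℝ} (hd : 0 < d) (hT : 0 < T) :
    ∫ x in Ioi (0:ℝ), Real.exp (-(d * x)) * truncatedBesselK T x =
      ∫ t in (0:ℝ)..T, d / (d ^ 2 + t ^ 2) / Real.sqrt (t ^ 2 + 1) := by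
  have hr := fun t => (sqrt_sq_add_one_pos t).ne'
  have hexp : IntegrableOn (fun x => Real.exp (-(d * x))) (Ioi 0) := by
    simpa [neg_mul] using exp_neg_integrableOn_Ioi 0 hd
  simp only [truncatedBesselK, intervalIntegral.integral_of_le hT.le, ← integral_const_mul]
  rw [integral_integral_swap]
  · refine integral_congr_ae (Eventually.of_forall fun t => ?_)
    simp only [← mul_div_assoc, integral_div, integral_exp_neg_mul_cos hd]
  · have hg := hexp.mul_prod (integrable_const (μ := volume.restrict (Ioc 0 T)) (1 : ℝ))
    refine hg.mono' ?_ (Eventually.of_forall fun p => ?_)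
    · refine Continuous.aestronglyMeasurable ?_
      refine (by fun_prop : Continuous _).mul ((by fun_prop : Continuous _).div (by fun_prop) ?_)
      exact fun p => hr p.2
    · rw [Function.uncurry, Real.norm_eq_abs, abs_mul, abs_of_pos (Real.exp_pos _), abs_div,
        abs_of_pos (sqrt_sq_add_one_pos _)]
      gcongr
      rw [div_le_one (sqrt_sq_add_one_pos _)]
      exact (Real.abs_cos_le_one _).trans (one_le_sqrt_sq_add_one _)

lemma integral_poissonKernel_div_sqrt {T : ℝ} (hT : 0 < T) :
    ∫ t in (0:ℝ)..T, T⁻¹ / (T⁻¹ ^ 2 + t ^ 2) / Real.sqrt (t ^ 2 + 1) =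
      ∫ u in Ioi (0:ℝ), (Iic (T ^ 2)).indicator
        (fun u => (1 + u ^ 2)⁻¹ / Real.sqrt ((T⁻¹ * u) ^ 2 + 1)) u := by
  have h := intervalIntegral.mul_integral_comp_mul_left (a := 0) (b := T ^ 2) (c := T⁻¹)
    (f := fun t => T⁻¹ / (T⁻¹ ^ 2 + t ^ 2) / Real.sqrt (t ^ 2 + 1))
  have e : T⁻¹ * T ^ 2 = T := by field_simp
  rw [mul_zero, e] at h
  rw [← h, ← intervalIntegral.integral_const_mul, setIntegral_indicator measurableSet_Iic,
    Ioi_inter_Iic, ← intervalIntegral.integral_of_le (by positivity)]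
  refine intervalIntegral.integral_congr fun u _ => ?_
  have hr := (sqrt_sq_add_one_pos (T⁻¹ * u)).ne'
  have : 1 + u ^ 2 ≠ 0 := by positivity
  have e2 : T⁻¹ ^ 2 + (T⁻¹ * u) ^ 2 = T⁻¹ ^ 2 * (1 + u ^ 2) := by ring
  rw [e2]
  generalize Real.sqrt ((T⁻¹ * u) ^ 2 + 1) = r at *
  field_simp

lemma tendsto_integral_poissonKernel_div_sqrt :
    Tendsto (fun T : ℝ => ∫ u in Ioi (0:ℝ), (Iic (T ^ 2)).indicator
        (fun u => (1 + u ^ 2)⁻¹ / Real.sqrt ((T⁻¹ * u) ^ 2 + 1)) u)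
      atTop (nhds (Real.pi / 2)) := by
  have hlim : Real.pi / 2 = ∫ u in Ioi (0:ℝ), (1 + u ^ 2)⁻¹ := by
    simp [integral_Ioi_inv_one_add_sq]
  rw [hlim]
  refine tendsto_integral_filter_of_dominated_convergence (fun u => (1 + u ^ 2)⁻¹)
    (Eventually.of_forall fun T => ?_) (Eventually.of_forall fun T => ?_)
    integrable_inv_one_add_sq.integrableOn (Eventually.of_forall fun u => ?_)
  · exact (Measurable.indicator (by fun_prop) measurableSet_Iic).aestronglyMeasurable
  · refine Eventually.of_forall fun u => (norm_indicator_le_norm_self _ _).trans ?_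
    rw [Real.norm_eq_abs, abs_of_nonneg (by positivity)]
    exact div_le_self (by positivity) (one_le_sqrt_sq_add_one _)
  · have h1 : Tendsto (fun T : ℝ => (1 + u ^ 2)⁻¹ / Real.sqrt ((T⁻¹ * u) ^ 2 + 1)) atTop
        (nhds ((1 + u ^ 2)⁻¹ / Real.sqrt ((0 * u) ^ 2 + 1))) :=
      tendsto_const_nhds.div
        ((((tendsto_inv_atTop_zero.mul_const u).pow 2).add_const 1).sqrt)
        (sqrt_sq_add_one_pos _).ne'
    simp only [zero_mul, ne_eq, OfNat.ofNat_ne_zero, not_false_eq_true, zero_pow, zero_add,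
      Real.sqrt_one, div_one] at h1
    refine h1.congr' ?_
    filter_upwards [(tendsto_pow_atTop (two_ne_zero)).eventually_ge_atTop u] with T hT
    rw [indicator_of_mem (show u ∈ Iic (T ^ 2) from hT)]

lemma continuous_truncatedBesselK (T : ℝ) : Continuous (truncatedBesselK T) := by
  refine intervalIntegral.continuous_parametric_intervalIntegral_of_continuous' ?_ 0 T
  exact (by fun_prop : Continuous _).div (by fun_prop) fun p => (sqrt_sq_add_one_pos p.2).ne'

theorem stmt_10 (K0 : ℝ → ℝ)
    (hK0 : ∀ x ∈ Ioi (0:ℝ),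
      Tendsto (fun T => ∫ t in (0:ℝ)..T, Real.cos (x * t) / Real.sqrt (t ^ 2 + 1))
        atTop (nhds (K0 x))) :
    ∫ x in Ioi (0:ℝ), K0 x = Real.pi / 2 := by
  obtain ⟨g, hg, hb⟩ := exists_integrableOn_bound_exp_mul_truncatedBesselK
  have hleft : Tendsto (fun T : ℝ =>
      ∫ x in Ioi (0:ℝ), Real.exp (-(T⁻¹ * x)) * truncatedBesselK T x)
      atTop (nhds (∫ x in Ioi (0:ℝ), K0 x)) := by
    refine tendsto_integral_filter_of_dominated_convergence g
      (Eventually.of_forall fun T => ?_) ?_ hg ?_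
    · exact ((by fun_prop : Continuous fun x : ℝ => Real.exp (-(T⁻¹ * x))).mul
        (continuous_truncatedBesselK T)).aestronglyMeasurable
    · filter_upwards [eventually_gt_atTop 0] with T hT
      exact (ae_restrict_iff' measurableSet_Ioi).2
        (Eventually.of_forall fun x hx => hb T x hT hx)
    · refine (ae_restrict_iff' measurableSet_Ioi).2 (Eventually.of_forall fun x hx => ?_)
      have h1 : Tendsto (fun T : ℝ => Real.exp (-(T⁻¹ * x))) atTop (nhds 1) := by
        simpa using (tendsto_inv_atTop_zero.mul_const x).neg.rexp
      simpa [truncatedBesselK] using h1.mul (hK0 x hx)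
  refine tendsto_nhds_unique hleft (tendsto_integral_poissonKernel_div_sqrt.congr' ?_)
  filter_upwards [eventually_gt_atTop 0] with T hT
  rw [integral_exp_mul_truncatedBesselK (inv_pos.2 hT) hT, integral_poissonKernel_div_sqrt hT]
end

section
/- For all a > 0 and b > 0, ∫_0^∞ x sin(b x) K₀(a x) dx = (π b / 2) (a² + b²)^{−3/2}. -/
open MeasureTheory Filter Set

lemma integrable_mul_of_abs_le_one {f g : ℝ → ℝ} {μ : Measure ℝ} (hg : Integrable g μ)
    (hf : Continuous f) (hb : ∀ x, |f x| ≤ 1) : Integrable (fun x => f x * g x) μ := by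
  refine hg.norm.mono' (hf.aestronglyMeasurable.mul hg.aestronglyMeasurable) (ae_of_all _ fun x => ?_)
  rw [norm_mul]
  exact mul_le_of_le_one_left (norm_nonneg _) (hb x)

lemma integrable_cos_mul_exp_neg_mul_sq {c : ℝ} (hc : 0 < c) (x : ℝ) :
    Integrable (fun t : ℝ => Real.cos (x * t) * Real.exp (-c * t ^ 2)) :=
  integrable_mul_of_abs_le_one (integrable_exp_neg_mul_sq hc) (by fun_prop)
    fun _ => Real.abs_cos_le_one _

lemma integral_Ioi_cos_mul_exp_neg_mul_sq {c : ℝ} (hc : 0 < c) (x : ℝ) :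
    ∫ t in Ioi (0 : ℝ), Real.cos (x * t) * Real.exp (-c * t ^ 2) =
      √(Real.pi / c) / 2 * Real.exp (-x ^ 2 / (4 * c)) := by
  have hpi : 0 ≤ Real.pi / c := by positivity
  have hF := fourierIntegral_gaussian (b := (c : ℂ)) (by simpa using hc) (x : ℂ)
  have hval : ((Real.pi : ℂ) / c) ^ (1 / 2 : ℂ) * Complex.exp (-(x : ℂ) ^ 2 / (4 * c)) =
      ((√(Real.pi / c) * Real.exp (-x ^ 2 / (4 * c)) : ℝ) : ℂ) := by
    rw [Real.sqrt_eq_rpow]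
    push_cast
    rw [Complex.ofReal_cpow hpi]
    push_cast
    rfl
  rw [hval] at hF
  have hpt : ∀ t : ℝ, RCLike.re (Complex.exp (Complex.I * x * t) * Complex.exp (-c * t ^ 2)) =
      Real.cos (x * t) * Real.exp (-c * t ^ 2) := by
    intro t
    have h1 : Complex.exp (-c * t ^ 2) = (Real.exp (-c * t ^ 2) : ℂ) := by push_cast; rfl
    have h2 : Complex.I * x * t = ((x * t : ℝ) : ℂ) * Complex.I := by push_cast; ring
    rw [h1, h2]
    simp only [RCLike.re_eq_complex_re]
    rw [Complex.re_mul_ofReal, Complex.exp_ofReal_mul_I_re]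
  have hint : Integrable
      (fun t : ℝ => Complex.exp (Complex.I * x * t) * Complex.exp (-c * t ^ 2)) := by
    refine (integrable_exp_neg_mul_sq hc).mono' (by fun_prop) (ae_of_all _ fun t => ?_)
    have h1 : Complex.exp (-c * t ^ 2) = (Real.exp (-c * t ^ 2) : ℂ) := by push_cast; rfl
    have h2 : Complex.I * x * t = ((x * t : ℝ) : ℂ) * Complex.I := by push_cast; ring
    rw [norm_mul, h1, h2, Complex.norm_exp_ofReal_mul_I, one_mul, Complex.norm_real,
      Real.norm_of_nonneg (Real.exp_nonneg _)]
  have hre := integral_re hint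
  rw [hF] at hre
  simp only [hpt] at hre
  have heven := integral_comp_abs (f := fun t => Real.cos (x * t) * Real.exp (-c * t ^ 2))
  have habs : ∀ t : ℝ, Real.cos (x * |t|) * Real.exp (-c * |t| ^ 2) =
      Real.cos (x * t) * Real.exp (-c * t ^ 2) := by
    intro t
    rw [sq_abs]
    rcases abs_choice t with h | h <;> rw [h]
    rw [mul_neg, Real.cos_neg]
  simp only [habs] at heven
  rw [hre] at heven
  simp only [RCLike.re_eq_complex_re, Complex.ofReal_re] at heven
  linarith

lemma integrable_id_mul_sin_mul_exp_neg_mul_sq {c : ℝ} (hc : 0 < c) (b : ℝ) :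
    Integrable (fun x : ℝ => x * Real.sin (b * x) * Real.exp (-c * x ^ 2)) := by
  have := integrable_mul_of_abs_le_one (f := fun x => Real.sin (b * x))
    (integrable_mul_exp_neg_mul_sq hc) (by fun_prop) fun _ => Real.abs_sin_le_one _
  refine this.congr (ae_of_all _ fun x => ?_)
  simp only
  ring

lemma tendsto_exp_neg_mul_sq_atTop {c : ℝ} (hc : 0 < c) :
    Tendsto (fun x : ℝ => Real.exp (-c * x ^ 2)) atTop (nhds 0) :=
  Real.tendsto_exp_atBot.comp
    ((tendsto_pow_atTop two_ne_zero).const_mul_atTop_of_neg (neg_neg_of_pos hc))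

lemma hasDerivAt_exp_neg_mul_sq (c x : ℝ) :
    HasDerivAt (fun x : ℝ => Real.exp (-c * x ^ 2)) (-(2 * c * x * Real.exp (-c * x ^ 2))) x := by
  convert ((hasDerivAt_pow 2 x).const_mul (-c)).exp using 1
  push_cast
  ring

lemma hasDerivAt_sin_const_mul (b x : ℝ) :
    HasDerivAt (fun x : ℝ => Real.sin (b * x)) (b * Real.cos (b * x)) x := by
  refine ((hasDerivAt_id x).const_mul b).sin.congr_deriv ?_
  rw [id, mul_one, mul_comm]

lemma integral_Ioi_id_mul_sin_mul_exp_neg_mul_sq {c : ℝ} (hc : 0 < c) (b : ℝ) :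
    ∫ x in Ioi (0 : ℝ), x * Real.sin (b * x) * Real.exp (-c * x ^ 2) =
      b / (2 * c) * (√(Real.pi / c) / 2 * Real.exp (-b ^ 2 / (4 * c))) := by
  have hd : ∀ x ∈ Ici (0 : ℝ), HasDerivAt
      (fun x : ℝ => Real.sin (b * x) * Real.exp (-c * x ^ 2))
      (b * (Real.cos (b * x) * Real.exp (-c * x ^ 2)) -
        2 * c * (x * Real.sin (b * x) * Real.exp (-c * x ^ 2))) x := by
    intro x _
    refine ((hasDerivAt_sin_const_mul b x).mul (hasDerivAt_exp_neg_mul_sq c x)).congr_deriv ?_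
    ring
  have h1 := ((integrable_cos_mul_exp_neg_mul_sq hc b).const_mul b).integrableOn (s := Ioi 0)
  have h2 := ((integrable_id_mul_sin_mul_exp_neg_mul_sq hc b).const_mul (2 * c)).integrableOn
    (s := Ioi 0)
  have ht : Tendsto (fun x : ℝ => Real.sin (b * x) * Real.exp (-c * x ^ 2)) atTop (nhds 0) := by
    refine squeeze_zero_norm (fun x => ?_) (tendsto_exp_neg_mul_sq_atTop hc)
    rw [norm_mul, Real.norm_of_nonneg (Real.exp_nonneg _)]
    exact mul_le_of_le_one_left (Real.exp_nonneg _) (Real.abs_sin_le_one _)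
  have h := integral_Ioi_of_hasDerivAt_of_tendsto' hd (h1.sub h2) ht
  rw [integral_sub h1 h2, integral_const_mul, integral_const_mul,
    integral_Ioi_cos_mul_exp_neg_mul_sq hc b] at h
  simp only [mul_zero, Real.sin_zero, zero_mul, sub_zero] at h
  rw [div_mul_eq_mul_div, eq_div_iff (by positivity)]
  linarith

lemma integral_Ioi_id_mul_exp_neg_mul_sq {c : ℝ} (hc : 0 < c) :
    ∫ x in Ioi (0 : ℝ), x * Real.exp (-c * x ^ 2) = (2 * c)⁻¹ := by
  have hd : ∀ x ∈ Ici (0 : ℝ), HasDerivAt (fun x : ℝ => -(2 * c)⁻¹ * Real.exp (-c * x ^ 2))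
      (x * Real.exp (-c * x ^ 2)) x := by
    intro x _
    refine ((hasDerivAt_exp_neg_mul_sq c x).const_mul (-(2 * c)⁻¹)).congr_deriv ?_
    field_simp
  have h := integral_Ioi_of_hasDerivAt_of_tendsto' hd
    (integrable_mul_exp_neg_mul_sq hc).integrableOn
    ((tendsto_exp_neg_mul_sq_atTop hc).const_mul _)
  simpa using h

/-- Truncated Gaussian cosine integrals are bounded uniformly in the Gaussian parameter. -/
lemma abs_intervalIntegral_cos_mul_exp_neg_mul_sq_le {c x T : ℝ} (hc : 0 ≤ c) (hx : 0 < x)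
    (hT : 0 ≤ T) :
    |∫ t in (0 : ℝ)..T, Real.cos (x * t) * Real.exp (-c * t ^ 2)| ≤ x⁻¹ := by
  have hparts := intervalIntegral.integral_mul_deriv_eq_deriv_mul (a := 0) (b := T)
    (u := fun t => Real.exp (-c * t ^ 2)) (v := fun t => Real.sin (x * t))
    (fun t _ => hasDerivAt_exp_neg_mul_sq c t) (fun t _ => hasDerivAt_sin_const_mul x t)
    (by apply Continuous.intervalIntegrable; fun_prop)
    (by apply Continuous.intervalIntegrable; fun_prop)
  have hexp : ∫ t in (0 : ℝ)..T, 2 * c * t * Real.exp (-c * t ^ 2) =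
      1 - Real.exp (-c * T ^ 2) := by
    have := intervalIntegral.integral_eq_sub_of_hasDerivAt (a := 0) (b := T)
      (fun t _ => (hasDerivAt_exp_neg_mul_sq c t).neg)
      (by apply Continuous.intervalIntegrable; fun_prop)
    simp only [neg_neg] at this
    rw [this]
    simp
    ring
  have hbound : |∫ t in (0 : ℝ)..T, -(2 * c * t * Real.exp (-c * t ^ 2)) * Real.sin (x * t)| ≤
      1 - Real.exp (-c * T ^ 2) := by
    rw [← hexp, ← Real.norm_eq_abs]
    refine intervalIntegral.norm_integral_le_of_norm_le hT (ae_of_all _ fun t ht => ?_)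
      (by apply Continuous.intervalIntegrable; fun_prop)
    have ht0 : 0 ≤ t := ht.1.le
    rw [norm_mul, norm_neg, Real.norm_of_nonneg (by positivity)]
    exact mul_le_of_le_one_right (by positivity) (Real.abs_sin_le_one _)
  have hleft : ∫ t in (0 : ℝ)..T, Real.exp (-c * t ^ 2) * (x * Real.cos (x * t)) =
      x * ∫ t in (0 : ℝ)..T, Real.cos (x * t) * Real.exp (-c * t ^ 2) := by
    rw [← intervalIntegral.integral_const_mul]
    congr 1
    ext t
    ring
  rw [hleft] at hparts
  simp only [mul_zero, Real.sin_zero, sub_zero] at hparts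
  have hsin : |Real.exp (-c * T ^ 2) * Real.sin (x * T)| ≤ Real.exp (-c * T ^ 2) := by
    rw [abs_mul, abs_of_nonneg (Real.exp_nonneg _)]
    exact mul_le_of_le_one_right (Real.exp_nonneg _) (Real.abs_sin_le_one _)
  have htri := abs_sub (Real.exp (-c * T ^ 2) * Real.sin (x * T))
    (∫ t in (0 : ℝ)..T, -(2 * c * t * Real.exp (-c * t ^ 2)) * Real.sin (x * t))
  rw [← hparts, abs_mul, abs_of_pos hx] at htri
  rw [← one_div, le_div_iff₀' hx]
  linarith

lemma integral_Ioi_rpow_neg_half_mul_exp {r : ℝ} (hr : 0 < r) :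
    ∫ s in Ioi (0 : ℝ), s ^ ((1 : ℝ) / 2 - 1) * Real.exp (-(r * s)) = √Real.pi / √r := by
  rw [Real.integral_rpow_mul_exp_neg_mul_Ioi (by norm_num) hr, Real.Gamma_one_half_eq,
    ← Real.sqrt_eq_rpow, one_div, Real.sqrt_inv]
  ring

lemma integrableOn_rpow_neg_half_mul_exp_neg :
    IntegrableOn (fun s : ℝ => s ^ ((1 : ℝ) / 2 - 1) * Real.exp (-s)) (Ioi 0) := by
  simpa only [mul_comm] using Real.GammaIntegral_convergent (s := 1 / 2) (by norm_num)

lemma intervalIntegral_cos_div_sqrt_eq (x : ℝ) {T : ℝ} (hT : 0 ≤ T) :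
    ∫ t in (0 : ℝ)..T, Real.cos (x * t) / √(t ^ 2 + 1) =
      ∫ s in Ioi (0 : ℝ), (√Real.pi)⁻¹ * (s ^ ((1 : ℝ) / 2 - 1) * Real.exp (-s)) *
        ∫ t in (0 : ℝ)..T, Real.cos (x * t) * Real.exp (-s * t ^ 2) := by
  have hpi : √Real.pi ≠ 0 := by positivity
  have hpt : ∀ t : ℝ, Real.cos (x * t) / √(t ^ 2 + 1) =
      ∫ s in Ioi (0 : ℝ), (√Real.pi)⁻¹ * (s ^ ((1 : ℝ) / 2 - 1) * Real.exp (-s)) *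
        (Real.cos (x * t) * Real.exp (-s * t ^ 2)) := by
    intro t
    have h := integral_Ioi_rpow_neg_half_mul_exp (r := t ^ 2 + 1) (by positivity)
    have heq : ∀ s : ℝ, (√Real.pi)⁻¹ * (s ^ ((1 : ℝ) / 2 - 1) * Real.exp (-s)) *
        (Real.cos (x * t) * Real.exp (-s * t ^ 2)) = (√Real.pi)⁻¹ * Real.cos (x * t) *
        (s ^ ((1 : ℝ) / 2 - 1) * Real.exp (-((t ^ 2 + 1) * s))) := by
      intro s
      rw [show -((t ^ 2 + 1) * s) = -s + -s * t ^ 2 by ring, Real.exp_add]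
      ring
    simp only [heq]
    rw [integral_const_mul, h]
    field_simp
  simp only [hpt, intervalIntegral.integral_of_le hT]
  rw [integral_integral_swap]
  · simp only [integral_const_mul]
  · have hw : Integrable (fun p : ℝ × ℝ => (1 : ℝ) *
        ((√Real.pi)⁻¹ * (p.2 ^ ((1 : ℝ) / 2 - 1) * Real.exp (-p.2))))
        ((volume.restrict (Ioc 0 T)).prod (volume.restrict (Ioi 0))) :=
      (integrable_const 1).mul_prod (integrableOn_rpow_neg_half_mul_exp_neg.const_mul _)
    refine hw.norm.mono' (Measurable.aestronglyMeasurable (by unfold Function.uncurry; fun_prop)) ?_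
    rw [Measure.prod_restrict]
    refine ae_restrict_of_forall_mem (measurableSet_Ioc.prod measurableSet_Ioi) fun p hp => ?_
    have hs : 0 < p.2 := hp.2
    rw [one_mul, Function.uncurry, norm_mul]
    refine mul_le_of_le_one_right (norm_nonneg _) ?_
    rw [norm_mul, Real.norm_of_nonneg (Real.exp_nonneg _)]
    refine mul_le_one₀ (Real.abs_cos_le_one _) (Real.exp_nonneg _) (Real.exp_le_one_iff.2 ?_)
    nlinarith [sq_nonneg p.1]

lemma tendsto_intervalIntegral_cos_div_sqrt {x : ℝ} (hx : 0 < x) :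
    Tendsto (fun T => ∫ t in (0 : ℝ)..T, Real.cos (x * t) / √(t ^ 2 + 1)) atTop
      (nhds (∫ s in Ioi (0 : ℝ), 2⁻¹ * (s⁻¹ * Real.exp (-s)) * Real.exp (-x ^ 2 / (4 * s)))) := by
  have hlim : ∫ s in Ioi (0 : ℝ), 2⁻¹ * (s⁻¹ * Real.exp (-s)) * Real.exp (-x ^ 2 / (4 * s)) =
      ∫ s in Ioi (0 : ℝ), (√Real.pi)⁻¹ * (s ^ ((1 : ℝ) / 2 - 1) * Real.exp (-s)) *
        ∫ t in Ioi (0 : ℝ), Real.cos (x * t) * Real.exp (-s * t ^ 2) := by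
    refine setIntegral_congr_fun measurableSet_Ioi fun s hs => ?_
    have hs : 0 < s := hs
    rw [integral_Ioi_cos_mul_exp_neg_mul_sq hs, Real.rpow_sub_one hs.ne', ← Real.sqrt_eq_rpow,
      Real.sqrt_div Real.pi_pos.le]
    have : √Real.pi ≠ 0 := by positivity
    have : √s ≠ 0 := by positivity
    field_simp
  rw [hlim]
  have hdom : Tendsto (fun T => ∫ s in Ioi (0 : ℝ),
      (√Real.pi)⁻¹ * (s ^ ((1 : ℝ) / 2 - 1) * Real.exp (-s)) *
        ∫ t in (0 : ℝ)..T, Real.cos (x * t) * Real.exp (-s * t ^ 2)) atTop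
      (nhds (∫ s in Ioi (0 : ℝ), (√Real.pi)⁻¹ * (s ^ ((1 : ℝ) / 2 - 1) * Real.exp (-s)) *
        ∫ t in Ioi (0 : ℝ), Real.cos (x * t) * Real.exp (-s * t ^ 2))) := by
    refine tendsto_integral_filter_of_dominated_convergence
      (fun s => ‖(√Real.pi)⁻¹ * (s ^ ((1 : ℝ) / 2 - 1) * Real.exp (-s))‖ * x⁻¹) ?_ ?_ ?_ ?_
    · refine Eventually.of_forall fun T => ?_
      refine AEStronglyMeasurable.mul
        (Measurable.aestronglyMeasurable (by fun_prop)) (Continuous.aestronglyMeasurable ?_)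
      exact intervalIntegral.continuous_parametric_intervalIntegral_of_continuous'
        (by unfold Function.uncurry; fun_prop) 0 T
    · filter_upwards [eventually_ge_atTop 0] with T hT
      refine ae_restrict_of_forall_mem measurableSet_Ioi fun s hs => ?_
      rw [norm_mul]
      exact mul_le_mul_of_nonneg_left
        (abs_intervalIntegral_cos_mul_exp_neg_mul_sq_le (le_of_lt hs) hx hT) (norm_nonneg _)
    · exact (integrableOn_rpow_neg_half_mul_exp_neg.const_mul _).norm.mul_const _
    · refine ae_restrict_of_forall_mem measurableSet_Ioi fun s hs => ?_
      exact (intervalIntegral_tendsto_integral_Ioi 0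
        (integrable_cos_mul_exp_neg_mul_sq hs x).integrableOn tendsto_id).const_mul _
  refine hdom.congr' ?_
  filter_upwards [eventually_ge_atTop 0] with T hT
  exact (intervalIntegral_cos_div_sqrt_eq x hT).symm

lemma integrable_prod_id_mul_exp_kernel {a : ℝ} (ha : 0 < a) :
    Integrable (fun p : ℝ × ℝ =>
        p.1 * (2⁻¹ * (p.2⁻¹ * Real.exp (-p.2)) * Real.exp (-(a ^ 2 / (4 * p.2)) * p.1 ^ 2)))
      ((volume.restrict (Ioi 0)).prod (volume.restrict (Ioi 0))) := by
  have hfac : ∀ x s : ℝ,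
      x * (2⁻¹ * (s⁻¹ * Real.exp (-s)) * Real.exp (-(a ^ 2 / (4 * s)) * x ^ 2)) =
      2⁻¹ * (s⁻¹ * Real.exp (-s)) * (x * Real.exp (-(a ^ 2 / (4 * s)) * x ^ 2)) :=
    fun x s => by ring
  rw [integrable_prod_iff' (Measurable.aestronglyMeasurable (by fun_prop))]
  simp only [hfac]
  constructor
  · refine ae_restrict_of_forall_mem measurableSet_Ioi fun s hs => ?_
    have hs : 0 < s := hs
    exact ((integrable_mul_exp_neg_mul_sq (by positivity)).integrableOn).const_mul _
  · have hexp : IntegrableOn (fun s : ℝ => (a ^ 2)⁻¹ * Real.exp (-s)) (Ioi 0) :=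
      (integrableOn_exp_neg_Ioi 0).const_mul _
    refine hexp.congr_fun (fun s hs => ?_) measurableSet_Ioi
    have hs : 0 < s := hs
    have hnorm : ∫ x in Ioi (0 : ℝ), ‖2⁻¹ * (s⁻¹ * Real.exp (-s)) *
          (x * Real.exp (-(a ^ 2 / (4 * s)) * x ^ 2))‖ =
        ∫ x in Ioi (0 : ℝ), 2⁻¹ * (s⁻¹ * Real.exp (-s)) *
          (x * Real.exp (-(a ^ 2 / (4 * s)) * x ^ 2)) := by
      refine setIntegral_congr_fun measurableSet_Ioi fun x hx => ?_
      have hx : 0 < x := hx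
      exact Real.norm_of_nonneg (by positivity)
    simp only
    rw [hnorm, integral_const_mul, integral_Ioi_id_mul_exp_neg_mul_sq (by positivity)]
    field_simp
    norm_num

lemma integral_Ioi_sqrt_mul_exp {a b : ℝ} (ha : 0 < a) :
    ∫ s in Ioi (0 : ℝ), √Real.pi * b / a ^ 3 *
        (s ^ ((3 : ℝ) / 2 - 1) * Real.exp (-((1 + b ^ 2 / a ^ 2) * s))) =
      (Real.pi * b / 2) * (a ^ 2 + b ^ 2) ^ (-(3 : ℝ) / 2) := by
  have hG : Real.Gamma (3 / 2) = √Real.pi / 2 := by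
    rw [show (3 : ℝ) / 2 = 1 / 2 + 1 by norm_num, Real.Gamma_add_one (by norm_num),
      Real.Gamma_one_half_eq]
    ring
  have hpow : (1 / (1 + b ^ 2 / a ^ 2)) ^ ((3 : ℝ) / 2) =
      a ^ 3 * (a ^ 2 + b ^ 2) ^ (-(3 : ℝ) / 2) := by
    have h1 : 1 / (1 + b ^ 2 / a ^ 2) = a ^ 2 / (a ^ 2 + b ^ 2) := by field_simp
    have h2 : (a ^ 2) ^ ((3 : ℝ) / 2) = a ^ 3 := by
      rw [← Real.rpow_natCast a 2, ← Real.rpow_mul ha.le, ← Real.rpow_natCast a 3]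
      norm_num
    rw [h1, Real.div_rpow (by positivity) (by positivity), h2, neg_div,
      Real.rpow_neg (by positivity), div_eq_mul_inv]
  rw [integral_const_mul, Real.integral_rpow_mul_exp_neg_mul_Ioi (by norm_num) (by positivity),
    hG, hpow]
  have hpi := Real.mul_self_sqrt Real.pi_pos.le
  field_simp
  linear_combination b * hpi

theorem stmt_13 (K0 : ℝ → ℝ)
    (hK0 : ∀ x ∈ Ioi (0:ℝ),
      Tendsto (fun T => ∫ t in (0:ℝ)..T, Real.cos (x * t) / Real.sqrt (t ^ 2 + 1))
        atTop (nhds (K0 x)))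
    (a b : ℝ) (ha : 0 < a) (hb : 0 < b) :
    ∫ x in Ioi (0:ℝ), x * Real.sin (b * x) * K0 (a * x) =
      (Real.pi * b / 2) * (a ^ 2 + b ^ 2) ^ (-(3 : ℝ) / 2) := by
  have hrepr : ∫ x in Ioi (0:ℝ), x * Real.sin (b * x) * K0 (a * x) =
      ∫ x in Ioi (0:ℝ), ∫ s in Ioi (0 : ℝ), Real.sin (b * x) *
        (x * (2⁻¹ * (s⁻¹ * Real.exp (-s)) * Real.exp (-(a ^ 2 / (4 * s)) * x ^ 2))) := by
    refine setIntegral_congr_fun measurableSet_Ioi fun x hx => ?_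
    have hax : 0 < a * x := mul_pos ha hx
    rw [tendsto_nhds_unique (hK0 _ hax) (tendsto_intervalIntegral_cos_div_sqrt hax),
      integral_const_mul, integral_const_mul, ← mul_assoc, mul_comm x]
    have hexp : ∀ s : ℝ, -(a * x) ^ 2 / (4 * s) = -(a ^ 2 / (4 * s)) * x ^ 2 := fun s => by ring
    simp only [hexp]
  rw [hrepr, integral_integral_swap, ← integral_Ioi_sqrt_mul_exp ha]
  · refine setIntegral_congr_fun measurableSet_Ioi fun s hs => ?_
    have hs : 0 < s := hs
    have hfac : ∀ x : ℝ, Real.sin (b * x) *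
        (x * (2⁻¹ * (s⁻¹ * Real.exp (-s)) * Real.exp (-(a ^ 2 / (4 * s)) * x ^ 2))) =
        2⁻¹ * (s⁻¹ * Real.exp (-s)) *
          (x * Real.sin (b * x) * Real.exp (-(a ^ 2 / (4 * s)) * x ^ 2)) := fun x => by ring
    simp only [hfac]
    have hsqrt : √(Real.pi / (a ^ 2 / (4 * s))) = 2 * √Real.pi * √s / a := by
      rw [show Real.pi / (a ^ 2 / (4 * s)) = Real.pi * s * (2 / a) ^ 2 by field_simp; norm_num,
        Real.sqrt_mul (by positivity), Real.sqrt_sq (by positivity),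
        Real.sqrt_mul Real.pi_pos.le]
      ring
    have hexp : Real.exp (-((1 + b ^ 2 / a ^ 2) * s)) =
        Real.exp (-s) * Real.exp (-b ^ 2 / (4 * (a ^ 2 / (4 * s)))) := by
      rw [← Real.exp_add]
      congr 1
      field_simp
      ring
    have hpow : s ^ ((3 : ℝ) / 2 - 1) = √s := by
      rw [Real.sqrt_eq_rpow]
      norm_num
    rw [integral_const_mul, integral_Ioi_id_mul_sin_mul_exp_neg_mul_sq (by positivity), hsqrt,
      hexp, hpow]
    field_simp
    norm_num
  · refine (integrable_prod_id_mul_exp_kernel ha).norm.mono'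
      (Measurable.aestronglyMeasurable (by unfold Function.uncurry; fun_prop))
      (ae_of_all _ fun p => ?_)
    rw [Function.uncurry, norm_mul]
    exact mul_le_of_le_one_left (norm_nonneg _) (Real.abs_sin_le_one _)
end

section
/- For every a > 0, ∫_0^∞ K₀(a x)² dx = π²/(4a). -/
open MeasureTheory Filter Set
open scoped FourierTransform Topology ContDiff

/-- The `L²` Fourier transform agrees a.e. with the Fourier integral on `L¹ ∩ L²`. -/
theorem fourier_toLp_ae_eq {f : ℝ → ℂ} (hf : Integrable f) (hf2 : MemLp f 2) :
    (𝓕 (hf2.toLp f) : Lp ℂ 2 (volume : Measure ℝ)) =ᵐ[volume] 𝓕 f := by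
  have hcont : Continuous (𝓕 f) :=
    VectorFourier.fourierIntegral_continuous Real.continuous_fourierChar
      continuous_inner hf
  refine ae_eq_of_integral_contDiff_smul_eq
    ((Lp.memLp _).locallyIntegrable (by norm_num)) hcont.locallyIntegrable ?_
  intro g hg hgc
  have hgc' : HasCompactSupport (fun x ↦ (g x : ℂ)) := hgc.comp_left (g := Complex.ofReal) rfl
  have hg' : ContDiff ℝ ∞ (fun x ↦ (g x : ℂ)) := Complex.ofRealCLM.contDiff.comp hg
  let φ : SchwartzMap ℝ ℂ := hgc'.toSchwartzMap hg'
  have hφ : ∀ x, φ x = (g x : ℂ) := fun x ↦ rfl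
  have h1 := congrArg (fun T ↦ T φ) (Lp.fourier_toTemperedDistribution_eq (hf2.toLp f))
  simp only [TemperedDistribution.fourier_apply, Lp.toTemperedDistribution_apply] at h1
  have h2 := VectorFourier.integral_fourierIntegral_smul_eq_flip (L := innerₗ ℝ)
    (μ := volume) (ν := volume) (f := φ) (g := f)
    Real.continuous_fourierChar continuous_inner φ.integrable hf
  calc ∫ x, g x • (𝓕 (hf2.toLp f) : Lp ℂ 2 (volume : Measure ℝ)) x
      = ∫ x, (𝓕 φ) x • (hf2.toLp f) x := by
        rw [h1]; rfl
    _ = ∫ x, (𝓕 φ) x • f x := by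
        refine integral_congr_ae ?_
        filter_upwards [hf2.coeFn_toLp] with x hx
        rw [hx]
    _ = ∫ x, g x • 𝓕 f x := by
        rw [flip_innerₗ] at h2
        exact h2

theorem tendsto_toLp_indicator_Icc {f : ℝ → ℂ} (hf : MemLp f 2) :
    Tendsto (fun n : ℕ ↦ (hf.indicator (measurableSet_Icc (a := -(n:ℝ)) (b := n))).toLp _)
      atTop (𝓝 (hf.toLp f)) := by
  rw [Lp.tendsto_Lp_iff_tendsto_eLpNorm'']
  have hlim : Tendsto (fun n : ℕ ↦ ∫⁻ x, ‖((Icc (-(n:ℝ)) n).indicator f - f) x‖ₑ ^ (2:ℝ))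
      atTop (𝓝 (∫⁻ _ : ℝ, 0)) := by
    refine tendsto_lintegral_of_dominated_convergence' (fun x ↦ ‖f x‖ₑ ^ (2:ℝ)) ?_ ?_ ?_ ?_
    · intro n
      exact (((hf.1.indicator measurableSet_Icc).sub hf.1).enorm).pow_const _
    · intro n
      filter_upwards with x
      gcongr
      by_cases hx : x ∈ Icc (-(n:ℝ)) n <;> simp [hx]
    · have := lintegral_rpow_enorm_lt_top_of_eLpNorm_lt_top (by norm_num) (by norm_num) hf.2
      simpa using this.ne
    · filter_upwards with x
      refine tendsto_const_nhds.congr' ?_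
      filter_upwards [eventually_ge_atTop ⌈|x|⌉₊] with n hn
      have : x ∈ Icc (-(n:ℝ)) n := by
        rw [mem_Icc, ← abs_le]; exact (Nat.le_ceil _).trans (by exact_mod_cast hn)
      simp [this]
  have := hlim.ennrpow_const (1/2 : ℝ)
  simpa [eLpNorm_eq_lintegral_rpow_enorm_toReal] using this

/-- Plancherel's identity for a pointwise a.e. limit of truncated Fourier integrals. -/
theorem integral_norm_sq_of_tendsto_fourier {f g : ℝ → ℂ} (hf : MemLp f 2)
    (h : ∀ᵐ ξ, Tendsto (fun n : ℕ ↦ 𝓕 ((Icc (-(n:ℝ)) n).indicator f) ξ) atTop (𝓝 (g ξ))) :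
    ∫ ξ, ‖g ξ‖ ^ 2 = ∫ x, ‖f x‖ ^ 2 := by
  have hlim := ((Lp.fourierTransformₗᵢ ℝ ℂ).continuous.tendsto _).comp
    (tendsto_toLp_indicator_Icc hf)
  obtain ⟨ns, hns, hae⟩ := (tendstoInMeasure_of_tendsto_Lp hlim).exists_seq_tendsto_ae
  have hint (n : ℕ) : Integrable ((Icc (-(n:ℝ)) n).indicator f) := by
    rw [integrable_indicator_iff measurableSet_Icc]
    exact (hf.restrict _).integrable (by norm_num)
  have hF : ∀ᵐ x, ∀ n : ℕ, _ := ae_all_iff.2 fun n ↦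
    fourier_toLp_ae_eq (hint n) (hf.indicator measurableSet_Icc)
  have hg : g =ᵐ[volume] (𝓕 (hf.toLp f) : Lp ℂ 2 (volume : Measure ℝ)) := by
    filter_upwards [h, hae, hF] with x h1 h2 h3
    refine tendsto_nhds_unique (h1.comp hns.tendsto_atTop) (h2.congr fun n ↦ ?_)
    exact h3 (ns n)
  have hnorm (u : Lp ℂ 2 (volume : Measure ℝ)) : ∫ x, ‖u x‖ ^ 2 = ‖u‖ ^ 2 := by
    have h := L2.inner_def (𝕜 := ℂ) u u
    simp_rw [inner_self_eq_norm_sq_to_K] at h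
    have h' : ((‖u‖ ^ 2 : ℝ) : ℂ) = ((∫ x, ‖u x‖ ^ 2 : ℝ) : ℂ) := by
      rw [← integral_complex_ofReal]; push_cast; exact h
    exact (Complex.ofReal_injective h').symm
  calc ∫ ξ, ‖g ξ‖ ^ 2 = ∫ ξ, ‖(𝓕 (hf.toLp f) : Lp ℂ 2 (volume : Measure ℝ)) ξ‖ ^ 2 :=
        integral_congr_ae (hg.mono fun x hx ↦ by simp only [hx])
    _ = ∫ x, ‖hf.toLp f x‖ ^ 2 := by rw [hnorm, hnorm, Lp.norm_fourier_eq]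
    _ = ∫ x, ‖f x‖ ^ 2 := integral_congr_ae (hf.coeFn_toLp.mono fun x hx ↦ by simp only [hx])

/-- The truncated Fourier integral of an even function is a cosine integral. -/
theorem fourier_indicator_Icc_of_even {w : ℝ → ℝ} (hw : Continuous w) (heven : ∀ t, w (-t) = w t)
    {R : ℝ} (hR : 0 ≤ R) (ξ : ℝ) :
    𝓕 ((Icc (-R) R).indicator fun t ↦ (w t : ℂ)) ξ =
      ((2 * ∫ t in (0:ℝ)..R, Real.cos (2 * Real.pi * ξ * t) * w t : ℝ) : ℂ) := by
  set F : ℝ → ℂ := fun t ↦ Complex.exp (↑(-2 * Real.pi * t * ξ) * Complex.I) * w t with hF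
  have hFc : Continuous F := by fun_prop
  have hFneg : Continuous fun t ↦ F (-t) := by fun_prop
  have hi (a b : ℝ) : IntervalIntegrable F volume a b := hFc.intervalIntegrable a b
  calc 𝓕 ((Icc (-R) R).indicator fun t ↦ (w t : ℂ)) ξ
      = ∫ t, (Icc (-R) R).indicator F t := by
        rw [Real.fourier_real_eq_integral_exp_smul]
        congr 1 with t
        by_cases ht : t ∈ Icc (-R) R <;> simp [ht, hF]
    _ = ∫ t in (-R)..R, F t := by
        rw [integral_indicator measurableSet_Icc, integral_Icc_eq_integral_Ioc,
          intervalIntegral.integral_of_le (by linarith)]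
    _ = ∫ t in (0:ℝ)..R, (F (-t) + F t) := by
        rw [← intervalIntegral.integral_add_adjacent_intervals (hi (-R) 0) (hi 0 R),
          intervalIntegral.integral_add (hFneg.intervalIntegrable 0 R) (hi 0 R),
          intervalIntegral.integral_comp_neg, neg_zero]
    _ = ∫ t in (0:ℝ)..R, ((2 * (Real.cos (2 * Real.pi * ξ * t) * w t) : ℝ) : ℂ) := by
        congr 1 with t
        simp only [hF, heven]
        push_cast
        rw [← mul_assoc, Complex.two_cos, add_mul]
        ring_nf
    _ = _ := by
        rw [intervalIntegral.integral_ofReal, intervalIntegral.integral_const_mul]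

theorem stmt_14 (K0 : ℝ → ℝ)
    (hK0 : ∀ x ∈ Ioi (0:ℝ),
      Tendsto (fun T => ∫ t in (0:ℝ)..T, Real.cos (x * t) / Real.sqrt (t ^ 2 + 1))
        atTop (nhds (K0 x)))
    (a : ℝ) (ha : 0 < a) :
    ∫ x in Ioi (0:ℝ), K0 (a * x) ^ 2 = Real.pi ^ 2 / (4 * a) := by
  have hπ := Real.pi_pos
  set w : ℝ → ℝ := fun t ↦ (Real.sqrt (t ^ 2 + 1))⁻¹ with hw
  have hwc : Continuous w :=
    (by fun_prop : Continuous fun t : ℝ ↦ Real.sqrt (t ^ 2 + 1)).inv₀ fun t ↦ by positivity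
  have hnorm : (fun t ↦ ‖(w t : ℂ)‖ ^ 2) = fun t ↦ (1 + t ^ 2)⁻¹ := by
    ext t
    rw [Complex.norm_real, Real.norm_eq_abs, sq_abs, hw, inv_pow, Real.sq_sqrt (by positivity),
      add_comm]
  have hL2 : MemLp (fun t ↦ (w t : ℂ)) 2 := by
    rw [memLp_two_iff_integrable_sq_norm (by fun_prop), hnorm]
    exact integrable_inv_one_add_sq
  have hlim : ∀ᵐ ξ : ℝ, Tendsto
      (fun n : ℕ ↦ 𝓕 ((Icc (-(n:ℝ)) n).indicator fun t ↦ (w t : ℂ)) ξ) atTop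
      (𝓝 ((2 * K0 (2 * Real.pi * |ξ|) : ℝ) : ℂ)) := by
    filter_upwards [Measure.ae_ne volume (0 : ℝ)] with ξ hξ
    simp_rw [fourier_indicator_Icc_of_even hwc (by simp [hw]) (Nat.cast_nonneg _)]
    refine (Complex.continuous_ofReal.tendsto _).comp (Tendsto.const_mul 2 ?_)
    have h := (hK0 (2 * Real.pi * |ξ|) (by simp only [mem_Ioi]; positivity)).comp
      tendsto_natCast_atTop_atTop
    refine h.congr fun n ↦ intervalIntegral.integral_congr fun t _ ↦ ?_
    rcases abs_choice ξ with h | h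
    · simp [h, hw, div_eq_mul_inv]
    · simp [h, hw, div_eq_mul_inv]
  have key := integral_norm_sq_of_tendsto_fourier hL2 hlim
  rw [hnorm, integral_univ_inv_one_add_sq] at key
  simp only [Complex.norm_real, Real.norm_eq_abs, sq_abs, mul_pow (2 : ℝ) (K0 _)] at key
  rw [integral_const_mul, integral_comp_abs (f := fun x ↦ K0 (2 * Real.pi * x) ^ 2),
    integral_comp_mul_left_Ioi (fun x ↦ K0 x ^ 2) 0 (by positivity : 0 < 2 * Real.pi),
    mul_zero, smul_eq_mul] at key
  rw [integral_comp_mul_left_Ioi (fun x ↦ K0 x ^ 2) 0 ha, mul_zero, smul_eq_mul]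
  field_simp at key ⊢
  linarith
end
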